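/- If all composition factors of a finite Moufang loop M are associative (i.e., groups), then M has a p-Sylow subloop for every prime p. -/

import Mathlib

open Pointwise

/-- A Moufang loop: a loop (binary operation with two-sided identity in which the equations
`a * x = b` and `y * a = b` have unique solutions) satisfying the Moufang identity. -/
class MoufangLoop (M : Type*) extends Mul M, One M where
  one_mul : ∀ a : M, 1 * a = a
  mul_one : ∀ a : M, a * 1 = a
  existsUnique_mul_left : ∀ a b : M, ∃! x : M, a * x = b
  existsUnique_mul_right : ∀ a b : M, ∃! y : M, y * a = b
  moufang : ∀ x y z : M, (x * y) * (z * x) = (x * (y * z)) * x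

namespace MoufangLoop

variable {M : Type*} [MoufangLoop M]

/-- The unique solution `x` of `a * x = b` (left division). -/
noncomputable def lsol (a b : M) : M := (existsUnique_mul_left a b).exists.choose

/-- The unique solution `y` of `y * a = b` (right division). -/
noncomputable def rsol (a b : M) : M := (existsUnique_mul_right a b).exists.choose

theorem mul_lsol (a b : M) : a * lsol a b = b := (existsUnique_mul_left a b).exists.choose_spec

theorem rsol_mul (a b : M) : rsol a b * a = b := (existsUnique_mul_right a b).exists.choose_spec

/-- A subloop: a subset closed under the loop operations (multiplication and the
two divisions; in particular it contains the identity). -/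
def IsSubloopSet (A : Set M) : Prop :=
  (1 : M) ∈ A ∧ (∀ x ∈ A, ∀ y ∈ A, x * y ∈ A) ∧
    (∀ x ∈ A, ∀ y ∈ A, lsol x y ∈ A) ∧ ∀ x ∈ A, ∀ y ∈ A, rsol x y ∈ A

/-- `B` is a normal subloop of the (sub)loop `A`:  `B ⊆ A` and, for all `x, y ∈ A`,
`B*x = x*B`, `B*(x*y) = (B*x)*y` and `(x*B)*y = x*(B*y)` (as subsets). -/
def IsNormalIn (B A : Set M) : Prop :=
  B ⊆ A ∧ (∀ x ∈ A, B * ({x} : Set M) = ({x} : Set M) * B) ∧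
    (∀ x ∈ A, ∀ y ∈ A, B * ({x * y} : Set M) = B * ({x} : Set M) * ({y} : Set M)) ∧
    ∀ x ∈ A, ∀ y ∈ A, ({x} : Set M) * B * ({y} : Set M) = ({x} : Set M) * (B * ({y} : Set M))

/-- A composition series of the subloop `A` of `M`: a strictly decreasing chain of
subloops from `A` to `{1}`, each normal in the preceding one, such that each step is
a maximal normal subloop of the preceding one (equivalently, by the correspondence
theorem, each factor is a simple loop). -/
structure CompSeriesOn (M : Type*) [MoufangLoop M] (A : Set M) where
  n : ℕ
  c : Fin (n + 1) → Set M
  subloop : ∀ i, IsSubloopSet (c i)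
  first : c 0 = A
  last : c (Fin.last n) = {1}
  normal : ∀ i : Fin n, IsNormalIn (c i.succ) (c i.castSucc)
  proper : ∀ i : Fin n, c i.succ ≠ c i.castSucc
  maximal : ∀ i : Fin n, ∀ D : Set M, IsSubloopSet D → IsNormalIn D (c i.castSucc) →
    c i.succ ⊆ D → D = c i.succ ∨ D = c i.castSucc

/-- A composition series of the loop `M` itself. -/
abbrev CompSeries (M : Type*) [MoufangLoop M] := CompSeriesOn M Set.univ

/-- `f` realizes `Q` as the quotient of the subloop `A` of `M` by its normal subloop `B`:
on `A`, `f` is multiplicative, maps onto `Q`, and its fibres are exactly the cosets of `B`.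
Thus `Q` is isomorphic to the factor loop `A/B`. -/
def IsFactorMap {Q : Type*} [Mul Q] (A B : Set M) (f : M → Q) : Prop :=
  (∀ x ∈ A, ∀ y ∈ A, f (x * y) = f x * f y) ∧ (∀ q : Q, ∃ x ∈ A, f x = q) ∧
    ∀ x ∈ A, ∀ y ∈ A, (f x = f y ↔ x ∈ ({y} : Set M) * B)

/-- A `p`-Sylow subloop: a subloop of order `p ^ k` where `p ^ k` is the largest power
of `p` dividing the order of `M`. -/
def IsPSylowSubloop (p : ℕ) (A : Set M) : Prop :=
  IsSubloopSet A ∧ Nat.card A = p ^ ((Nat.card M).factorization p)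

end MoufangLoop

namespace MoufangLoop

variable {M : Type*} [MoufangLoop M]

/-- The composition factor `A/B` is associative, i.e. a group. -/
def FactorAssociative (A B : Set M) : Prop :=
  ∀ x ∈ A, ∀ y ∈ A, ∀ z ∈ A, (x * y) * z ∈ ({x * (y * z)} : Set M) * B

/-- The subloop `A` is of group type: all of its composition factors are groups. -/
def GroupTypeSet (A : Set M) : Prop :=
  ∀ (s : CompSeriesOn M A) (i : Fin s.n), FactorAssociative (s.c i.castSucc) (s.c i.succ)

/-- Every normal subloop of `Q` of group type is trivial (i.e. `Gr(Q) = 1`). -/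
def NoNontrivialGroupTypeNormal (Q : Type*) [MoufangLoop Q] : Prop :=
  ∀ D : Set Q, IsSubloopSet D → IsNormalIn D Set.univ → GroupTypeSet D → D = ({1} : Set Q)

end MoufangLoop

universe u

/-- A group with two involutory endomorphisms generating an action of `S₃` which satisfies the
triality identity. -/
structure Triality (G : Type*) [Group G] where
  s : G →* G
  t : G →* G
  ss : ∀ x, s (s x) = x
  tt : ∀ x, t (t x) = x
  tst : ∀ x, t (s (t x)) = s (t (s x))
  tri : ∀ x, (x⁻¹ * s x) * t (s (x⁻¹ * s x)) * s (t (x⁻¹ * s x)) = 1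

namespace Triality

variable {G : Type*} [Group G] (T : Triality G)

attribute [simp] ss tt tst

/-- The third involution of `S₃`. -/
def z : G →* G := T.s.comp (T.t.comp T.s)

@[simp] theorem z_apply (x : G) : T.z x = T.s (T.t (T.s x)) := rfl

/-- The commutator of `x` with the involution `s`. -/
def m (x : G) : G := x⁻¹ * T.s x

theorem s_m (x : G) : T.s (T.m x) = (T.m x)⁻¹ := by simp [m]

theorem tri_m (x : G) : T.m x * T.t (T.s (T.m x)) * T.s (T.t (T.m x)) = 1 := T.tri x

theorem tri_m' (x : G) : T.s (T.t (T.m x)) = T.t (T.m x) * (T.m x)⁻¹ := by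
  have h := T.tri_m x
  rw [s_m, map_inv, mul_assoc, mul_eq_one_iff_inv_eq] at h
  rw [← mul_right_inj (T.t (T.m x))⁻¹, ← h]; group

theorem m_s (x : G) : T.m (T.s x) = (T.m x)⁻¹ := by simp [m]

theorem m_comm (x : G) : Commute (T.m x) (T.t (T.m x)) := by
  have h1 := T.tri_m' x
  have h2 := T.tri_m' (T.s x)
  rw [m_s, map_inv, map_inv, h1] at h2
  rw [Commute, SemiconjBy]
  have h3 := congrArg Inv.inv h2
  simp only [mul_inv_rev, inv_inv] at h3
  rw [← mul_left_inj (T.m x)⁻¹, mul_assoc, h3]; group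

/-- Exchanging the roles of `t` and `z`. -/
def swapZ : Triality G where
  s := T.s
  t := T.z
  ss := T.ss
  tt x := by simp
  tst x := by simp
  tri x := by
    have h := T.tri_m' x
    have hc := (T.m_comm x)
    change T.m x * T.z (T.s (T.m x)) * T.s (T.z (T.m x)) = 1
    simp only [z_apply, ss]
    rw [s_m, h, map_inv, ← hc.inv_left.eq, ← mul_assoc, mul_inv_cancel, one_mul, mul_inv_cancel]

/-- Exchanging the roles of `s` and `t`. -/
def swap : Triality G where
  s := T.t
  t := T.s
  ss := T.tt
  tt := T.ss
  tst x := by simp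
  tri x := by
    have h := T.swapZ.tri_m (T.t (T.s x))
    have e : x⁻¹ * T.t x = T.s (T.t (T.m (T.t (T.s x)))) := by simp [m]
    rw [e]
    have hc := T.m_comm (T.t (T.s x))
    have h2 := T.tri_m' (T.t (T.s x))
    have h3 := T.s_m (T.t (T.s x))
    generalize T.m (T.t (T.s x)) = u at *
    simp only [tt, h3, h2, map_mul, map_inv, hc.inv_left.symm.eq, inv_inv, mul_inv_rev]
    group

/-- Invariance under both involutions. -/
def Inv (K : Subgroup G) : Prop := (∀ x ∈ K, T.s x ∈ K) ∧ ∀ x ∈ K, T.t x ∈ K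

/-- The subgroup of elements fixed by `s`. -/
def F : Subgroup G := T.s.eqLocus (MonoidHom.id G)

@[simp] theorem mem_F {x : G} : x ∈ T.F ↔ T.s x = x := Iff.rfl

variable {T}

theorem Inv.swap {K : Subgroup G} (h : T.Inv K) : T.swap.Inv K := ⟨h.2, h.1⟩

theorem Inv.swapZ {K : Subgroup G} (h : T.Inv K) : T.swapZ.Inv K :=
  ⟨h.1, fun _ hx => h.1 _ (h.2 _ (h.1 _ hx))⟩

theorem Inv.m_mem {K : Subgroup G} (h : T.Inv K) {x : G} (hx : x ∈ K) : T.m x ∈ K :=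
  K.mul_mem (K.inv_mem hx) (h.1 _ hx)

theorem Inv.bot : T.Inv ⊥ := by simp [Inv]

theorem Inv.top : T.Inv ⊤ := by simp [Inv]

theorem Inv.inf {K L : Subgroup G} (hK : T.Inv K) (hL : T.Inv L) : T.Inv (K ⊓ L) :=
  ⟨fun x hx => ⟨hK.1 x hx.1, hL.1 x hx.2⟩, fun x hx => ⟨hK.2 x hx.1, hL.2 x hx.2⟩⟩

theorem Inv.sup {K L : Subgroup G} (hK : T.Inv K) (hL : T.Inv L) : T.Inv (K ⊔ L) := by
  constructor
  · change K ⊔ L ≤ (K ⊔ L).comap T.s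
    exact sup_le (fun x hx => Subgroup.mem_sup_left (hK.1 x hx))
      (fun x hx => Subgroup.mem_sup_right (hL.1 x hx))
  · change K ⊔ L ≤ (K ⊔ L).comap T.t
    exact sup_le (fun x hx => Subgroup.mem_sup_left (hK.2 x hx))
      (fun x hx => Subgroup.mem_sup_right (hL.2 x hx))

theorem Inv.normalizer {K : Subgroup G} (hK : T.Inv K) :
    T.Inv (Subgroup.normalizer (K : Set G)) := by
  constructor
  · intro x hx
    rw [Subgroup.mem_normalizer_iff] at hx ⊢
    intro h
    have := hx (T.s h)
    constructor
    · intro hh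
      have := hK.1 _ (this.1 (hK.1 _ hh))
      simpa using this
    · intro hh
      have h2 := hK.1 _ hh
      simp only [map_mul, ss, map_inv] at h2
      simpa using hK.1 _ (this.2 h2)
  · intro x hx
    rw [Subgroup.mem_normalizer_iff] at hx ⊢
    intro h
    have := hx (T.t h)
    constructor
    · intro hh
      have := hK.2 _ (this.1 (hK.2 _ hh))
      simpa using this
    · intro hh
      have h2 := hK.2 _ hh
      simp only [map_mul, tt, map_inv] at h2
      simpa using hK.2 _ (this.2 h2)

variable (T)

/-- The involution `s` as an automorphism. -/
def sE : G ≃* G := { T.s with invFun := T.s, left_inv := T.ss, right_inv := T.ss }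

/-- The involution `t` as an automorphism. -/
def tE : G ≃* G := { T.t with invFun := T.t, left_inv := T.tt, right_inv := T.tt }

variable {T}

theorem Inv.of_characteristic {K : Subgroup G} [h : K.Characteristic] : T.Inv K := by
  rw [Subgroup.characteristic_iff_le_comap] at h
  exact ⟨h T.sE, h T.tE⟩

variable (T)

/-- The restriction to an invariant subgroup. -/
def restrict {K : Subgroup G} (h : T.Inv K) : Triality K where
  s := (T.s.comp K.subtype).codRestrict K fun x => h.1 _ x.2
  t := (T.t.comp K.subtype).codRestrict K fun x => h.2 _ x.2
  ss _ := Subtype.ext (T.ss _)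
  tt _ := Subtype.ext (T.tt _)
  tst _ := Subtype.ext (T.tst _)
  tri _ := Subtype.ext (T.tri _)

@[simp] theorem restrict_s {K : Subgroup G} (h : T.Inv K) (x : K) :
    (((T.restrict h).s x : K) : G) = T.s x := rfl

@[simp] theorem restrict_t {K : Subgroup G} (h : T.Inv K) (x : K) :
    (((T.restrict h).t x : K) : G) = T.t x := rfl

theorem restrict_F {K : Subgroup G} (h : T.Inv K) : (T.restrict h).F = T.F.subgroupOf K := by
  ext x
  simp [Subgroup.mem_subgroupOf, Subtype.ext_iff]

theorem restrict_inv {K : Subgroup G} (h : T.Inv K) {L : Subgroup K} :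
    (T.restrict h).Inv L ↔ T.Inv (L.map K.subtype) := by
  constructor
  · rintro ⟨h1, h2⟩
    constructor
    · rintro _ ⟨x, hx, rfl⟩; exact ⟨_, h1 x hx, rfl⟩
    · rintro _ ⟨x, hx, rfl⟩; exact ⟨_, h2 x hx, rfl⟩
  · rintro ⟨h1, h2⟩
    constructor
    · intro x hx
      obtain ⟨y, hy, e⟩ := h1 x ⟨x, hx, rfl⟩
      have : y = (T.restrict h).s x := Subtype.ext e
      rwa [← this]
    · intro x hx
      obtain ⟨y, hy, e⟩ := h2 x ⟨x, hx, rfl⟩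
      have : y = (T.restrict h).t x := Subtype.ext e
      rwa [← this]

/-- The quotient by an invariant normal subgroup. -/
def quot (X : Subgroup G) [X.Normal] (h : T.Inv X) : Triality (G ⧸ X) where
  s := QuotientGroup.map X X T.s h.1
  t := QuotientGroup.map X X T.t h.2
  ss x := by
    induction x using QuotientGroup.induction_on with | H x => ?_
    exact congrArg (QuotientGroup.mk' X) (T.ss x)
  tt x := by
    induction x using QuotientGroup.induction_on with | H x => ?_
    exact congrArg (QuotientGroup.mk' X) (T.tt x)
  tst x := by
    induction x using QuotientGroup.induction_on with | H x => ?_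
    exact congrArg (QuotientGroup.mk' X) (T.tst x)
  tri x := by
    induction x using QuotientGroup.induction_on with | H x => ?_
    exact congrArg (QuotientGroup.mk' X) (T.tri x)

variable {X : Subgroup G} [X.Normal] (hX : T.Inv X)

@[simp] theorem quot_s (x : G) : (T.quot X hX).s (x : G ⧸ X) = (T.s x : G) := rfl
@[simp] theorem quot_t (x : G) : (T.quot X hX).t (x : G ⧸ X) = (T.t x : G) := rfl

theorem quot_fix_s {x : G} : (T.quot X hX).s (x : G ⧸ X) = x ↔ T.m x ∈ X := by
  rw [quot_s, eq_comm, QuotientGroup.eq]; rfl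

theorem quot_inv_comap {K : Subgroup (G ⧸ X)} :
    (T.quot X hX).Inv K ↔ T.Inv (K.comap (QuotientGroup.mk' X)) := by
  constructor
  · rintro ⟨h1, h2⟩
    exact ⟨fun x hx => h1 _ hx, fun x hx => h2 _ hx⟩
  · rintro ⟨h1, h2⟩
    constructor
    · intro x; induction x using QuotientGroup.induction_on; exact h1 _
    · intro x; induction x using QuotientGroup.induction_on; exact h2 _

theorem quot_inv_map {K : Subgroup G} (hK : T.Inv K) :
    (T.quot X hX).Inv (K.map (QuotientGroup.mk' X)) := by
  constructor
  · rintro _ ⟨x, hx, rfl⟩; exact ⟨_, hK.1 x hx, rfl⟩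
  · rintro _ ⟨x, hx, rfl⟩; exact ⟨_, hK.2 x hx, rfl⟩

/-- A canonical element with the same commutator with `s` as `g`. -/
def lift (g : G) : G := T.z (T.m g)⁻¹

theorem m_lift (g : G) : T.m (T.lift g) = T.m g := by
  have h := T.tri_m' g
  simp only [m, lift, z_apply, ss]
  rw [← m, map_inv, s_m, inv_inv, h]
  simp

omit [X.Normal] in
theorem lift_mem (hX : T.Inv X) {g : G} (h : T.m g ∈ X) : T.lift g ∈ X :=
  hX.swapZ.2 _ (X.inv_mem h)

theorem mul_inv_mem_F {g h : G} (e : T.m g = T.m h) : T.s (g * h⁻¹) = g * h⁻¹ := by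
  have h1 : T.s g = g * T.m g := by simp [m]
  have h2 : T.s h = h * T.m h := by simp [m]
  rw [map_mul, map_inv, h1, h2, e]; group

omit [X.Normal] in
/-- An element commuting with `s` modulo `X` is a product of a fixed element and one of `X`. -/
theorem exists_fix_mul (hX : T.Inv X) {g : G} (h : T.m g ∈ X) :
    ∃ x ∈ X, T.s (g * x⁻¹) = g * x⁻¹ :=
  ⟨T.lift g, T.lift_mem hX h, T.mul_inv_mem_F (T.m_lift g).symm⟩

theorem comap_F_inf {K : Subgroup G} (hXK : X ≤ K) :
    (T.quot X hX).F.comap (QuotientGroup.mk' X) ⊓ K = (T.F ⊓ K) ⊔ X := by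
  apply le_antisymm
  · rintro x ⟨hx, hxK⟩
    obtain ⟨y, hy, e⟩ := T.exists_fix_mul hX ((T.quot_fix_s hX).1 hx)
    rw [← inv_mul_cancel_right x y]
    exact Subgroup.mul_mem_sup ⟨e, K.mul_mem hxK (K.inv_mem (hXK hy))⟩ hy
  · refine sup_le (fun x hx => ⟨?_, hx.2⟩) (fun x hx => ⟨?_, hXK hx⟩)
    · exact congrArg (QuotientGroup.mk' X) hx.1
    · exact (T.quot_fix_s hX).2 (hX.m_mem hx)

theorem _root_.Subgroup.relIndex_sup_of_normal [Finite G] (H N : Subgroup G) [N.Normal] :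
    H.relIndex (H ⊔ N) = H.relIndex N := by
  have h1 := Subgroup.relIndex_mul_relIndex (H ⊓ N) H (H ⊔ N) inf_le_left le_sup_left
  have h2 := Subgroup.relIndex_mul_relIndex (H ⊓ N) N (H ⊔ N) inf_le_right le_sup_right
  rw [Subgroup.relIndex_sup_right, ← h1, Subgroup.inf_relIndex_left, Subgroup.inf_relIndex_right,
    mul_comm] at h2
  exact (Nat.eq_of_mul_eq_mul_left (Nat.pos_of_ne_zero Subgroup.index_ne_zero_of_finite) h2).symm

theorem relIndex_quot [Finite G] {K : Subgroup G} (hXK : X ≤ K) :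
    T.F.relIndex K = (T.quot X hX).F.relIndex (K.map (QuotientGroup.mk' X)) * T.F.relIndex X := by
  rw [← Subgroup.inf_relIndex_right T.F K,
    ← Subgroup.relIndex_mul_relIndex (T.F ⊓ K) ((T.F ⊓ K) ⊔ X) K le_sup_left
      (sup_le inf_le_right hXK), ← T.comap_F_inf hX hXK, Subgroup.inf_relIndex_right,
    Subgroup.relIndex_comap, T.comap_F_inf hX hXK, Subgroup.relIndex_sup_of_normal, mul_comm]
  congr 1
  rw [← Subgroup.inf_relIndex_right (T.F ⊓ K), inf_assoc, inf_eq_right.2 hXK,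
    Subgroup.inf_relIndex_right]

theorem index_quot [Finite G] :
    T.F.index = (T.quot X hX).F.index * T.F.relIndex X := by
  have := T.relIndex_quot hX le_top
  rwa [Subgroup.relIndex_top_right, Subgroup.map_top_of_surjective _
    (QuotientGroup.mk'_surjective X),
    Subgroup.relIndex_top_right] at this

omit [X.Normal] in
theorem dvd_relIndex_of_index [Finite G] {p : ℕ} (hp : p.Prime) {K : Subgroup G} (hK : ¬ p ∣ K.index)
    (k : ℕ)
    (h : p ^ k ∣ T.F.index) : p ^ k ∣ T.F.relIndex K := by
  have h1 : T.F.index ∣ T.F.relIndex K * K.index := by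
    rw [← Subgroup.inf_relIndex_right, Subgroup.relIndex_mul_index inf_le_right]
    exact Subgroup.index_dvd_of_le inf_le_left
  exact (Nat.Coprime.pow_left k ((Nat.Prime.coprime_iff_not_dvd hp).2 hK)).dvd_of_dvd_mul_right
    (h.trans h1)

end Triality

namespace Triality

variable {G : Type*} [Group G] (T : Triality G)

/-- The subgroup generated by the commutators of elements of `K` with `s`. -/
def G1 (K : Subgroup G) : Subgroup G := Subgroup.closure (T.m '' K)

/-- The triple commutator of the three rotations of `T.G1 K`. -/
def tripleComm (K : Subgroup G) : Subgroup G :=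
  ⁅⁅T.G1 K, (T.G1 K).map T.t⁆, ((T.G1 K).map T.t).map T.s⁆

/-- The group-theoretic counterpart of being a Moufang loop of group type. -/
def GT : Prop :=
  ∀ K : Subgroup G, T.Inv K → (∃ h ∈ K, T.s h ≠ h) →
    ∃ Y ≤ K, T.Inv Y ∧ T.tripleComm K ≤ Y ∧ ∃ h ∈ K, T.m h ∉ Y

theorem m_eq_one {x : G} : T.m x = 1 ↔ T.s x = x := by
  rw [m, inv_mul_eq_one, eq_comm]

section Map

variable {T} {G' : Type*} [Group G'] {T' : Triality G'} {f : G →* G'}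
  (hs : ∀ x, T'.s (f x) = f (T.s x)) (ht : ∀ x, T'.t (f x) = f (T.t x))

include hs

theorem map_m (x : G) : T'.m (f x) = f (T.m x) := by simp [m, hs]

theorem map_G1 (K : Subgroup G) : T'.G1 (K.map f) = (T.G1 K).map f := by
  rw [G1, G1, MonoidHom.map_closure, Subgroup.coe_map, Set.image_image, Set.image_image]
  simp only [map_m hs]

include ht

theorem map_tripleComm (K : Subgroup G) : T'.tripleComm (K.map f) = (T.tripleComm K).map f := by
  have e1 : T'.s.comp f = f.comp T.s := MonoidHom.ext hs
  have e2 : T'.t.comp f = f.comp T.t := MonoidHom.ext ht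
  simp only [tripleComm, map_G1 hs, Subgroup.map_commutator, Subgroup.map_map, e2]
  rw [← MonoidHom.comp_assoc, e1, MonoidHom.comp_assoc]

end Map

variable {T}

theorem GT.restrict (hT : T.GT) {K : Subgroup G} (hK : T.Inv K) : (T.restrict hK).GT := by
  rintro L hL ⟨h, hh, hne⟩
  obtain ⟨Y, hY, hYi, hC, g, hg, hgY⟩ := hT (L.map K.subtype) ((T.restrict_inv hK).1 hL)
    ⟨h, ⟨h, hh, rfl⟩, fun e => hne (Subtype.ext e)⟩
  have hYK : Y ≤ K := hY.trans (Subgroup.map_subtype_le L)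
  refine ⟨Y.subgroupOf K, ?_, ?_, ?_, ?_⟩
  · rintro x hx
    obtain ⟨y, hy, e⟩ := hY hx
    have : y = x := Subtype.ext e
    rwa [← this]
  · rw [restrict_inv, Subgroup.subgroupOf_map_subtype]
    exact hYi.inf hK
  · rw [Subgroup.subgroupOf, ← Subgroup.map_le_iff_le_comap,
      ← map_tripleComm (T := T.restrict hK) (T' := T) (fun _ => rfl) (fun _ => rfl)]
    exact hC
  · obtain ⟨x, hx, rfl⟩ := hg
    exact ⟨x, hx, hgY⟩

theorem GT.quot [Finite G] (hT : T.GT) {X : Subgroup G} [X.Normal] (hX : T.Inv X) :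
    (T.quot X hX).GT := by
  rintro L hL ⟨h, hh, hne⟩
  let f := QuotientGroup.mk' X
  have hf : Function.Surjective f := QuotientGroup.mk'_surjective X
  set T' := T.quot X hX
  have hs : ∀ x, T'.s (f x) = f (T.s x) := fun _ => rfl
  have ht : ∀ x, T'.t (f x) = f (T.t x) := fun _ => rfl
  let C : Set (Subgroup G) := {K | T.Inv K ∧ K ≤ L.comap f ∧ T'.m '' L = T'.m '' (K.map f)}
  have hCne : C.Nonempty := ⟨L.comap f, (T.quot_inv_comap hX).1 hL, le_rfl, by
    rw [Subgroup.map_comap_eq_self_of_surjective hf]⟩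
  obtain ⟨K, ⟨hKi, hKL, hKm⟩, hmin⟩ := (Set.toFinite C).exists_minimal hCne
  have hG1 : T'.G1 L = T'.G1 (K.map f) := by rw [G1, G1, hKm]
  obtain ⟨Y, hYK, hYi, hYC, g, hg, hgY⟩ := hT K hKi (by
    by_contra! hfix
    have : T'.m h ∈ T'.m '' (K.map f) := hKm ▸ ⟨h, hh, rfl⟩
    obtain ⟨_, ⟨k, hk, rfl⟩, e⟩ := this
    rw [map_m hs, T.m_eq_one.2 (hfix k hk), map_one, eq_comm, m_eq_one] at e
    exact hne e)
  refine ⟨Y.map f, Subgroup.map_le_iff_le_comap.2 (hYK.trans hKL), T.quot_inv_map hX hYi, ?_, ?_⟩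
  · rw [tripleComm, hG1, ← tripleComm, map_tripleComm hs ht]
    exact Subgroup.map_mono hYC
  · by_contra! hall
    have : Y ∈ C := by
      refine ⟨hYi, hYK.trans hKL, ?_⟩
      apply subset_antisymm
      · rintro _ ⟨x, hx, rfl⟩
        exact ⟨T'.lift x, T'.lift_mem (T.quot_inv_map hX hYi) (hall x hx), T'.m_lift x⟩
      · rintro _ ⟨_, ⟨x, hx, rfl⟩, rfl⟩
        exact ⟨f x, hKL (hYK hx), rfl⟩
    exact hgY (hmin this hYK (hKi.m_mem hg))

end Triality

namespace Triality

/-- The existence of an invariant `p`-subgroup whose orbit of the base point is as large as the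
`p`-part of the index of the fixed subgroup. -/
def HasSylow {G : Type*} [Group G] (p : ℕ) (T : Triality G) : Prop :=
  ∃ P : Subgroup G, IsPGroup p P ∧ T.Inv P ∧ ∀ k, p ^ k ∣ T.F.index → p ^ k ∣ T.F.relIndex P

/-- The conclusion of the main theorem for groups of order less than `n`. -/
def SylowBelow (p n : ℕ) : Prop :=
  ∀ (H : Type u) [Group H] [Finite H] (T : Triality H), T.GT → Nat.card H < n → T.HasSylow p

variable {G : Type u} [Group G] {T : Triality G}

theorem conj_m (b h : G) : b⁻¹ * T.m h * b = T.m (h * b) * (T.m b)⁻¹ := by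
  simp [m]; group

theorem m_mem_G1 {K : Subgroup G} {x : G} (h : x ∈ K) : T.m x ∈ T.G1 K :=
  Subgroup.subset_closure ⟨x, h, rfl⟩

theorem le_normalizer_G1 (K : Subgroup G) : K ≤ Subgroup.normalizer (T.G1 K : Set G) := by
  have key : ∀ b ∈ K, ∀ h ∈ T.G1 K, b⁻¹ * h * b ∈ T.G1 K := by
    intro b hb
    have : T.G1 K ≤ (T.G1 K).comap (MulAut.conj b⁻¹).toMonoidHom := by
      rw [G1, Subgroup.closure_le]
      rintro _ ⟨h, hh, rfl⟩
      change (MulAut.conj b⁻¹) (T.m h) ∈ T.G1 K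
      rw [MulAut.conj_apply, inv_inv, conj_m]
      exact Subgroup.mul_mem _ (m_mem_G1 (K.mul_mem hh hb)) (Subgroup.inv_mem _ (m_mem_G1 hb))
    intro h hh
    simpa using this hh
  intro b hb
  rw [Subgroup.mem_normalizer_iff]
  intro h
  constructor
  · intro hh
    simpa using key b⁻¹ (K.inv_mem hb) h hh
  · intro hh
    have := key b hb _ hh
    simpa [mul_assoc] using this

instance normal_G1 : (T.G1 ⊤).Normal := by
  rw [← Subgroup.normalizer_eq_top_iff, eq_top_iff]
  exact le_normalizer_G1 ⊤

variable (T) in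
/-- The subgroup generated by all commutators with involutions. -/
def comm : Subgroup G := T.G1 ⊤ ⊔ (T.G1 ⊤).map T.t ⊔ ((T.G1 ⊤).map T.t).map T.s

theorem m_mem_comm (x : G) : T.m x ∈ T.comm :=
  Subgroup.mem_sup_left (Subgroup.mem_sup_left (m_mem_G1 trivial))

instance normal_comm : T.comm.Normal := by
  have h1 : ((T.G1 ⊤).map T.t).Normal := normal_G1.map _ fun x => ⟨T.t x, T.tt x⟩
  have h2 : (((T.G1 ⊤).map T.t).map T.s).Normal := h1.map _ fun x => ⟨T.s x, T.ss x⟩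
  unfold comm
  infer_instance

theorem s_G1 (K : Subgroup G) : (T.G1 K).map T.s ≤ T.G1 K := by
  rw [Subgroup.map_le_iff_le_comap, G1, Subgroup.closure_le]
  rintro _ ⟨x, hx, rfl⟩
  change T.s (T.m x) ∈ T.G1 K
  rw [s_m]
  exact Subgroup.inv_mem _ (m_mem_G1 hx)

theorem map_ss (K : Subgroup G) : (K.map T.s).map T.s = K := by
  rw [Subgroup.map_map]; convert K.map_id; ext; simp

theorem map_tt (K : Subgroup G) : (K.map T.t).map T.t = K := by
  rw [Subgroup.map_map]; convert K.map_id; ext; simp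

theorem map_tst (K : Subgroup G) : ((K.map T.t).map T.s).map T.t =
    ((K.map T.s).map T.t).map T.s := by
  simp only [Subgroup.map_map]; congr 1; ext; simp

theorem inv_comm : T.Inv T.comm := by
  have hs : T.comm.map T.s ≤ T.comm := by
    simp only [comm, Subgroup.map_sup, map_ss]
    refine sup_le (sup_le ((s_G1 _).trans ?_) le_sup_right) ?_
    · exact le_sup_of_le_left le_sup_left
    · exact le_sup_of_le_left le_sup_right
  have ht : T.comm.map T.t ≤ T.comm := by
    simp only [comm, Subgroup.map_sup, map_tt, map_tst]
    refine sup_le (sup_le ?_ ?_) ?_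
    · exact le_sup_of_le_left le_sup_right
    · exact le_sup_of_le_left le_sup_left
    · exact le_sup_of_le_right (Subgroup.map_mono (Subgroup.map_mono (s_G1 _)))
  exact ⟨fun x hx => hs ⟨x, hx, rfl⟩, fun x hx => ht ⟨x, hx, rfl⟩⟩

/-- Every invariant subgroup containing all commutators with `s` contains `T.comm`. -/
theorem comm_le {K : Subgroup G} (hK : T.Inv K) (h : ∀ g, T.m g ∈ K) : T.comm ≤ K := by
  have h1 : T.G1 ⊤ ≤ K := by
    rw [G1, Subgroup.closure_le]
    rintro _ ⟨g, -, rfl⟩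
    exact h g
  have h2 : (T.G1 ⊤).map T.t ≤ K := by
    rintro _ ⟨x, hx, rfl⟩
    exact hK.2 _ (h1 hx)
  refine sup_le (sup_le h1 h2) ?_
  rintro _ ⟨x, hx, rfl⟩
  exact hK.1 _ (h2 hx)

variable [Finite G] {p : ℕ}

theorem HasSylow.of_subgroup (ih : SylowBelow.{u} p (Nat.card G)) (hT : T.GT) {K : Subgroup G}
    (hK : T.Inv K) (hne : K ≠ ⊤) (hn : ∀ k, p ^ k ∣ T.F.index → p ^ k ∣ T.F.relIndex K) :
    T.HasSylow p := by
  obtain ⟨P, hP, hPi, hk⟩ := ih K (T.restrict hK) (hT.restrict hK)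
    (lt_of_le_of_ne (Subgroup.card_le_card_group K) fun h => hne (Subgroup.eq_top_of_card_eq K h))
  refine ⟨P.map K.subtype, hP.map _, (T.restrict_inv hK).1 hPi, fun k h => ?_⟩
  have := hk k
  rw [restrict_F, Subgroup.subgroupOf, Subgroup.relIndex_comap] at this
  exact this (hn k h)

theorem HasSylow.of_quot (ih : SylowBelow.{u} p (Nat.card G)) (hT : T.GT) {X : Subgroup G}
    [X.Normal] (hX : T.Inv X) (hne : X ≠ ⊥) : (T.quot X hX).HasSylow p := by
  refine ih _ _ (hT.quot hX) ?_
  have h1 := Subgroup.card_eq_card_quotient_mul_card_subgroup X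
  have h2 : 1 < Nat.card X := (Subgroup.one_lt_card_iff_ne_bot X).2 hne
  rw [h1]
  exact lt_mul_of_one_lt_right Nat.card_pos h2

theorem HasSylow.of_comm_ne_top (ih : SylowBelow.{u} p (Nat.card G)) (hT : T.GT)
    (h : T.comm ≠ ⊤) : T.HasSylow p := by
  refine HasSylow.of_subgroup ih hT inv_comm h fun k hk => ?_
  have : (T.quot T.comm inv_comm).F = ⊤ := by
    rw [eq_top_iff]
    intro x _
    induction x using QuotientGroup.induction_on
    exact (T.quot_fix_s inv_comm).2 (m_mem_comm _)
  rwa [T.index_quot inv_comm, this, Subgroup.index_top, one_mul] at hk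

theorem dvd_relIndex_quot {X P : Subgroup G} [X.Normal] (hX : T.Inv X) (hXP : X ≤ P)
    (h : ∀ k, p ^ k ∣ (T.quot X hX).F.index →
      p ^ k ∣ (T.quot X hX).F.relIndex (P.map (QuotientGroup.mk' X))) (hp : p.Prime) (k : ℕ)
    (hk : p ^ k ∣ T.F.index) : p ^ k ∣ T.F.relIndex P := by
  rw [T.index_quot hX] at hk
  rw [T.relIndex_quot hX hXP]
  obtain ⟨a, b, ha, hb, e⟩ := (Nat.dvd_mul).1 hk
  obtain ⟨i, -, rfl⟩ := (Nat.dvd_prime_pow hp).1 (Dvd.intro _ e)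
  rw [← e]
  exact mul_dvd_mul (h _ ha) hb

theorem HasSylow.of_normal_p [hp : Fact p.Prime] (ih : SylowBelow.{u} p (Nat.card G)) (hT : T.GT)
    {R X : Subgroup G} [hXn : X.Normal] (hRX : R ≤ X) (hR : IsPGroup p R) (hR0 : R ≠ ⊥)
    (hRi : T.Inv R) (hpR : ¬ p ∣ R.relIndex X) : T.HasSylow p := by
  by_cases hK : Subgroup.normalizer (R : Set G) = ⊤
  · have hRn : R.Normal := Subgroup.normalizer_eq_top_iff.1 hK
    obtain ⟨P, hP, hPi, hk⟩ := HasSylow.of_quot ih hT hRi hR0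
    have hRP : R ≤ P.comap (QuotientGroup.mk' R) := fun x hx => by
      rw [Subgroup.mem_comap, QuotientGroup.mk'_apply, (QuotientGroup.eq_one_iff x).2 hx]
      exact P.one_mem
    refine ⟨P.comap (QuotientGroup.mk' R), hP.comap_of_ker_isPGroup _
      (by rwa [QuotientGroup.ker_mk']),
      (T.quot_inv_comap hRi).1 hPi, dvd_relIndex_quot hRi hRP ?_ hp.out⟩
    rwa [Subgroup.map_comap_eq_self_of_surjective (QuotientGroup.mk'_surjective R)]
  · refine HasSylow.of_subgroup ih hT hRi.normalizer hK
      (T.dvd_relIndex_of_index hp.out fun hd => hpR ?_)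
    let S : Sylow p X := (hR.comap_subtype (K := X)).toSylow hpR
    have h1 := S.normalizer_sup_eq_top
    have h2 : (S : Subgroup X).map X.subtype = R := by
      change (R.subgroupOf X).map X.subtype = R
      rw [Subgroup.subgroupOf_map_subtype, inf_eq_left.2 hRX]
    rw [h2] at h1
    have h3 := Subgroup.relIndex_sup_of_normal (Subgroup.normalizer (R : Set G)) X
    rw [h1, Subgroup.relIndex_top_right] at h3
    rw [h3] at hd
    exact hd.trans (Subgroup.relIndex_dvd_of_le_left X Subgroup.le_normalizer)

end Triality

namespace Triality

variable {G : Type u} [Group G] {T : Triality G} [Finite G] {p : ℕ}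

omit [Finite G] in
theorem HasSylow.of_not_dvd (h : ¬ p ∣ T.F.index) : T.HasSylow p := by
  refine ⟨⊥, IsPGroup.of_bot, Inv.bot, fun k hk => ?_⟩
  rcases k with _ | k
  · simp
  · exact absurd ((dvd_pow_self p k.succ_ne_zero).trans hk) h

omit [Finite G] in
theorem HasSylow.of_not_dvd_card (h : ¬ p ∣ Nat.card G) : T.HasSylow p :=
  HasSylow.of_not_dvd fun h' => h (h'.trans (Subgroup.index_dvd_card _))

theorem HasSylow.or_isPGroup_quot [hp : Fact p.Prime] (ih : SylowBelow.{u} p (Nat.card G))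
    (hT : T.GT) {X : Subgroup G} [X.Normal] (hX : T.Inv X) (hne : X ≠ ⊥) :
    T.HasSylow p ∨ IsPGroup p (G ⧸ X) := by
  obtain ⟨P, hP, hPi, hk⟩ := HasSylow.of_quot ih hT hX hne
  by_cases h : P = ⊤
  · subst h
    exact .inr (hP.of_equiv Subgroup.topEquiv)
  · left
    have hXP : X ≤ P.comap (QuotientGroup.mk' X) := fun x hx => by
      rw [Subgroup.mem_comap, QuotientGroup.mk'_apply, (QuotientGroup.eq_one_iff x).2 hx]
      exact P.one_mem
    have hmap := Subgroup.map_comap_eq_self_of_surjective (QuotientGroup.mk'_surjective X) P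
    refine HasSylow.of_subgroup ih hT ((T.quot_inv_comap hX).1 hPi) (fun e => h ?_)
      (dvd_relIndex_quot hX hXP (by rwa [hmap]) hp.out)
    rw [← hmap, e, Subgroup.map_top_of_surjective _ (QuotientGroup.mk'_surjective X)]

variable [hp : Fact p.Prime] (ih : SylowBelow.{u} p (Nat.card G)) (hT : T.GT)
  {X : Subgroup G} [X.Normal] (hpX : ¬ p ∣ Nat.card X) (hQ : IsPGroup p (G ⧸ X))

include ih hT hpX hQ

theorem HasSylow.of_centralized (hc : ∀ g : G, ∀ x ∈ X, g * x = x * g) : T.HasSylow p := by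
  let R : Sylow p G := default
  have h1 : (R : Subgroup G) ⊔ X = ⊤ := by
    rw [← Subgroup.index_eq_one]
    obtain ⟨n, hn⟩ := hQ.index ⊥
    rw [Subgroup.index_bot] at hn
    have hd : ((R : Subgroup G) ⊔ X).index ∣ p ^ n := by
      rw [← hn]; exact Subgroup.index_dvd_of_le le_sup_right
    have hd' : ((R : Subgroup G) ⊔ X).index ∣ (R : Subgroup G).index :=
      Subgroup.index_dvd_of_le le_sup_left
    exact Nat.eq_one_of_dvd_coprimes
      (((Nat.Prime.coprime_iff_not_dvd hp.out).2 R.not_dvd_index).pow_left n) hd hd'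
  have h2 : (R : Subgroup G).Normal := by
    rw [← Subgroup.normalizer_eq_top_iff, eq_top_iff, ← h1]
    refine sup_le Subgroup.le_normalizer fun x hx => ?_
    rw [Subgroup.mem_normalizer_iff]
    intro h
    rw [← hc h x hx, mul_inv_cancel_right]
  by_cases hR : (R : Subgroup G) = ⊥
  · rw [hR, bot_sup_eq] at h1
    refine HasSylow.of_not_dvd_card ?_
    rwa [h1, Subgroup.card_top] at hpX
  · have := R.characteristic_of_normal h2
    exact HasSylow.of_normal_p ih hT (X := ⊤) le_top R.2 hR Inv.of_characteristic
      (by rw [Subgroup.relIndex_top_right]; exact R.not_dvd_index)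

theorem HasSylow.of_factorization (hX : T.Inv X)
    (hf : ∀ b ∈ X, ∃ a ∈ X, ∃ c ∈ X, T.s a = a ∧ T.t c = c ∧ b = a * c) : T.HasSylow p := by
  set f := QuotientGroup.mk' X with hfdef
  set T' := T.quot X hX
  have hfX : ∀ {x}, x ∈ X → f x = 1 := fun {x} hx => (QuotientGroup.eq_one_iff x).2 hx
  let D : Subgroup (G ⧸ X) := Subgroup.center (G ⧸ X) ⊓ (T'.F ⊓ T'.swap.F)
  have hDi : T'.Inv D := ⟨fun x hx => by rwa [T'.mem_F.1 hx.2.1],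
    fun x hx => by
      have : T'.t x = x := hx.2.2
      rwa [this]⟩
  let L : Subgroup G := D.comap f
  have hLi : T.Inv L := (T.quot_inv_comap hX).1 hDi
  have hDn : D.Normal := ⟨fun x hx g => by
    have := Subgroup.mem_center_iff.1 hx.1 g
    rwa [this, mul_inv_cancel_right]⟩
  let E : Subgroup G := L ⊓ (T.F ⊓ T.swap.F)
  have hXL : X ≤ L := fun x hx => by
    rw [Subgroup.mem_comap, hfX hx]; exact D.one_mem
  have hEL : E ⊔ X = L := by
    refine le_antisymm (sup_le inf_le_left hXL) fun g hg => ?_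
    have hgm : T.m g ∈ X := (T.quot_fix_s hX).1 hg.2.1
    obtain ⟨x, hx, h1⟩ := T.exists_fix_mul hX hgm
    have hg1 : g * x⁻¹ ∈ L := L.mul_mem hg (L.inv_mem (hXL hx))
    generalize hgg : g * x⁻¹ = g1 at *
    have hgm1 : T.swap.m g1 ∈ X := (T.swap.quot_fix_s (X := X) hX.swap).1 hg1.2.2
    obtain ⟨y, hy, h2⟩ := T.swap.exists_fix_mul hX.swap hgm1
    obtain ⟨a, ha, c, hc, h3, h4, h5⟩ := hf _ (X.inv_mem hy)
    have key : g1 * a = (g1 * y⁻¹) * c⁻¹ := by rw [h5]; group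
    have hE : g1 * a ∈ E := by
      refine ⟨L.mul_mem hg1 (hXL ha), ?_, ?_⟩
      · change T.s (g1 * a) = g1 * a
        rw [map_mul, h1, h3]
      · change T.t (g1 * a) = g1 * a
        rw [key, map_mul, map_inv, h4]
        congr 1
    have : g = g1 * a * (a⁻¹ * x) := by rw [← hgg]; group
    rw [this]
    exact Subgroup.mul_mem_sup hE (X.mul_mem (X.inv_mem ha) hx)
  have hEi : ∀ K ≤ E, T.Inv K := fun K hK =>
    ⟨fun x hx => by rwa [T.mem_F.1 (hK hx).2.1], fun x hx => by
      have : T.t x = x := (hK hx).2.2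
      rwa [this]⟩
  let S : Sylow p E := default
  let C : Subgroup G := (S : Subgroup E).map E.subtype
  have hCE : C ≤ E := Subgroup.map_subtype_le _
  have hCidx : ¬ p ∣ C.relIndex E := by
    have := S.not_dvd_index
    rwa [Subgroup.relIndex, Subgroup.subgroupOf,
      Subgroup.comap_map_eq_self_of_injective E.subtype_injective]
  by_cases hC : C = ⊥
  · have hD : D = ⊥ := by
      have hmap : E.map f = D := by
        rw [← Subgroup.map_comap_eq_self_of_surjective (QuotientGroup.mk'_surjective X) D,
          ← hfdef, show D.comap f = L from rfl, ← hEL, Subgroup.map_sup,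
          (Subgroup.map_eq_bot_iff X).2 (by rw [QuotientGroup.ker_mk']), sup_bot_eq]
      rw [hC, Subgroup.relIndex_bot_left] at hCidx
      rw [← Subgroup.card_eq_one]
      obtain ⟨n, hn⟩ := IsPGroup.iff_card.1 (hQ.to_subgroup D)
      rcases n with _ | n
      · simpa using hn
      · refine absurd ?_ hCidx
        have : Nat.card D ∣ Nat.card E := by rw [← hmap]; exact Subgroup.card_map_dvd _ _
        exact ((dvd_pow_self p n.succ_ne_zero).trans (by rw [hn])).trans this
    rcases subsingleton_or_nontrivial (G ⧸ X) with hsub | hnt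
    · have := QuotientGroup.subgroup_eq_top_of_subsingleton X hsub
      subst this
      exact HasSylow.of_not_dvd_card (by rwa [Subgroup.card_top] at hpX)
    have hcn := hQ.center_nontrivial
    have hci : T'.Inv (Subgroup.center (G ⧸ X)) := Inv.of_characteristic
    obtain ⟨z, hzc, hz⟩ : ∃ z ∈ Subgroup.center (G ⧸ X), T'.s z ≠ z := by
      by_contra! hall
      obtain ⟨⟨z, hzc⟩, hz⟩ := exists_ne (1 : Subgroup.center (G ⧸ X))
      refine hz (Subtype.ext ?_)
      have : z ∈ D := by
        refine ⟨hzc, hall z hzc, ?_⟩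
        change T'.t z = z
        have h1 := hall z hzc
        have h2 := hall _ (hci.2 _ hzc)
        have h3 := T'.tst z
        rw [h1, h2, T'.tt] at h3
        exact h3.symm
      rwa [hD] at this
    obtain ⟨z, rfl⟩ := QuotientGroup.mk'_surjective X z
    have hm1 : f (T.m z) ≠ 1 := fun e => hz ((T.quot_fix_s hX).2 ((QuotientGroup.eq_one_iff _).1 e))
    have hmc : f (T.m z) ∈ Subgroup.center (G ⧸ X) := hci.m_mem hzc
    set N := Nat.card X
    set u := T.m z ^ N with hu
    have huc : f u ∈ Subgroup.center (G ⧸ X) := by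
      rw [hu, map_pow]; exact Subgroup.pow_mem _ hmc _
    have hvc : f (T.t u) ∈ Subgroup.center (G ⧸ X) := hci.2 _ huc
    obtain ⟨e, he⟩ := hQ (f (T.m z))
    have hup : u ^ p ^ e = 1 := by
      have h1 : T.m z ^ p ^ e ∈ X := (QuotientGroup.eq_one_iff _).1 he
      have h2 := pow_card_eq_one' (x := (⟨_, h1⟩ : X))
      rw [hu, ← pow_mul, mul_comm, pow_mul]
      exact congrArg Subtype.val h2
    have hu1 : u ≠ 1 := by
      intro h
      have h1 : f (T.m z) ^ N = 1 := by rw [← map_pow, ← hu, h, map_one]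
      refine hm1 (orderOf_eq_one_iff.1 (Nat.eq_one_of_dvd_coprimes
        (((Nat.Prime.coprime_iff_not_dvd hp.out).2 hpX).pow_left e)
        (orderOf_dvd_of_pow_eq_one he) (orderOf_dvd_of_pow_eq_one h1)))
    have hsu : T.s u = u⁻¹ := by rw [hu, map_pow, s_m, inv_pow]
    have huv : Commute u (T.t u) := by
      rw [hu, map_pow]; exact (T.m_comm z).pow_pow _ _
    have hsv : T.s (T.t u) = T.t u * u⁻¹ := by
      rw [hu, map_pow, map_pow, T.tri_m', (T.m_comm z).symm.inv_right.mul_pow, inv_pow]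
    have hzp : ∀ w : G, w ^ p ^ e = 1 → IsPGroup p (Subgroup.zpowers w) := by
      rintro w hw ⟨_, ⟨i, rfl⟩⟩
      refine ⟨e, Subtype.ext ?_⟩
      change (w ^ i) ^ p ^ e = 1
      rw [← zpow_natCast, zpow_comm, zpow_natCast, hw, one_zpow]
    let K : Subgroup G := Subgroup.zpowers u ⊔ Subgroup.zpowers (T.t u)
    have huK : u ∈ K := Subgroup.mem_sup_left (Subgroup.mem_zpowers u)
    have hvK : T.t u ∈ K := Subgroup.mem_sup_right (Subgroup.mem_zpowers _)
    have hKp : IsPGroup p K := by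
      refine (hzp u hup).to_sup_of_normal_right' (hzp _ (by rw [← map_pow, hup, map_one])) ?_
      rw [Subgroup.zpowers_le, Subgroup.mem_normalizer_iff]
      intro h
      constructor
      · rintro ⟨i, rfl⟩
        exact ⟨i, by simp [(huv.zpow_right i).eq]⟩
      · rintro ⟨i, hi⟩
        refine ⟨i, ?_⟩
        simp only at hi ⊢
        rw [← mul_left_inj u⁻¹, ← mul_right_inj u, ← mul_assoc, ← mul_assoc, ← hi]
        simp [(huv.zpow_right i).eq]
    have hKi : T.Inv K := by
      constructor
      · change K ≤ K.comap T.s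
        refine sup_le (Subgroup.zpowers_le.2 ?_) (Subgroup.zpowers_le.2 ?_)
        · rw [Subgroup.mem_comap, hsu]; exact K.inv_mem huK
        · rw [Subgroup.mem_comap, hsv]; exact K.mul_mem hvK (K.inv_mem huK)
      · change K ≤ K.comap T.t
        refine sup_le (Subgroup.zpowers_le.2 ?_) (Subgroup.zpowers_le.2 ?_)
        · exact hvK
        · rw [Subgroup.mem_comap, tt]; exact huK
    have hYn : (K ⊔ X).Normal := by
      rw [sup_comm, ← QuotientGroup.comap_map_mk']
      have : K.map f ≤ Subgroup.center (G ⧸ X) := by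
        rw [Subgroup.map_le_iff_le_comap]
        exact sup_le (Subgroup.zpowers_le.2 huc) (Subgroup.zpowers_le.2 hvc)
      have : (K.map f).Normal := ⟨fun x hx g => by
        rwa [Subgroup.mem_center_iff.1 (this hx) g, mul_inv_cancel_right]⟩
      infer_instance
    refine HasSylow.of_normal_p ih hT (X := K ⊔ X) le_sup_left hKp ?_ hKi ?_
    · intro h
      rw [h] at huK
      exact hu1 huK
    · rw [Subgroup.relIndex_sup_of_normal]
      exact fun h => hpX (h.trans (Subgroup.relIndex_dvd_card _ _))
  · refine HasSylow.of_normal_p ih hT (X := L) (hCE.trans inf_le_left) (S.2.map _) hC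
      (hEi C hCE) ?_
    rw [← Subgroup.relIndex_mul_relIndex C E L hCE inf_le_left, hp.out.dvd_mul, not_or]
    refine ⟨hCidx, ?_⟩
    rw [← hEL, Subgroup.relIndex_sup_of_normal]
    exact fun h => hpX (h.trans (Subgroup.relIndex_dvd_card _ _))

end Triality

theorem Subgroup.exists_addMap {G : Type u} [Group G] {X S : Subgroup G}
    (hc : ∀ x ∈ X, ∀ y ∈ X, x * y = y * x) :
    ∃ (V : Type u) (_ : AddCommGroup V) (φ : G → V),
      (∀ x ∈ X, ∀ y ∈ X, φ (x * y) = φ x + φ y) ∧ ∀ x ∈ X, φ x = 0 ↔ x ∈ S := by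
  classical
  let : CommGroup X :=
    { (inferInstance : Group X) with mul_comm := fun x y => Subtype.ext (hc x x.2 y y.2) }
  refine ⟨Additive (X ⧸ S.subgroupOf X), inferInstance,
    fun g => if h : g ∈ X then Additive.ofMul (QuotientGroup.mk ⟨g, h⟩) else 0, ?_, ?_⟩
  · intro x hx y hy
    simp only [hx, hy, X.mul_mem hx hy, dif_pos]
    rfl
  · intro x hx
    simp only [hx, dif_pos]
    rw [ofMul_eq_zero, QuotientGroup.eq_one_iff, Subgroup.mem_subgroupOf]

namespace Triality

variable {G : Type u} [Group G] {T : Triality G} {X : Subgroup G} [X.Normal] (hX : T.Inv X)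
  {V : Type u} [AddCommGroup V] {φ : G → V} (hφ : ∀ x ∈ X, ∀ y ∈ X, φ (x * y) = φ x + φ y)
  (hs : ∀ x ∈ X, φ (T.s x) = - φ x) (h3 : ∀ x ∈ X, φ x + φ x + φ x = 0)

omit [X.Normal] in
include hφ in
theorem addMap_one : φ 1 = 0 := by
  have := hφ 1 X.one_mem 1 X.one_mem
  rw [one_mul] at this
  exact left_eq_add.1 this

omit [X.Normal] in
include hφ in
theorem addMap_inv {x : G} (hx : x ∈ X) : φ x⁻¹ = - φ x := by
  have := hφ x hx _ (X.inv_mem hx)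
  rw [mul_inv_cancel, addMap_one hφ] at this
  exact (neg_eq_of_add_eq_zero_right this.symm).symm

include hX hφ hs h3

theorem addMap_conj_rotate (ht : ∀ x ∈ X, φ (T.t x) = - φ x) (g : G) {x : G} (hx : x ∈ X) :
    φ (T.m g * T.t (T.s x) * (T.m g)⁻¹) = φ (T.m g * T.s x * (T.m g)⁻¹) - φ x := by
  have hcj : ∀ y ∈ X, ∀ k : G, k * y * k⁻¹ ∈ X := fun y hy k => ‹X.Normal›.conj_mem y hy k
  have e : T.m (g * x) = x⁻¹ * T.m g * T.s x := by simp [m, mul_assoc]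
  have key := T.tri_m' (g * x)
  have hn := T.tri_m' g
  rw [e] at key
  generalize T.m g = m at *
  have hcn : ∀ y ∈ X, φ (T.t m * y * (T.t m)⁻¹) = - φ (m * T.t y * m⁻¹) := fun y hy => by
    rw [← ht _ (hcj _ (hX.2 _ hy) _)]; simp
  have hck : ∀ y ∈ X, φ (T.t m * m⁻¹ * y * (T.t m * m⁻¹)⁻¹) = φ (m * T.t (T.s y) * m⁻¹) :=
    fun y hy => by
      have h1 := hcn _ (hX.1 _ hy)
      rw [← neg_eq_iff_eq_neg, ← hs _ (hcj _ (hX.1 _ hy) _), map_mul, map_mul, map_inv, hn,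
        ss] at h1
      exact h1
  have key2 : (T.s (T.t x))⁻¹ *
      (T.t m * m⁻¹ * T.s (T.t (T.s x)) * (T.t m * m⁻¹)⁻¹) =
      (T.t x)⁻¹ * (T.t m * (T.t (T.s x) * (T.s x)⁻¹) * (T.t m)⁻¹) *
        (T.t m * m⁻¹ * x * (T.t m * m⁻¹)⁻¹) := by
    simp only [map_mul, map_inv, hn] at key
    have := congrArg (· * (T.t m * m⁻¹)⁻¹) key
    simp only [mul_inv_rev, inv_inv, mul_assoc] at this ⊢
    rw [this]; group
  have hsx := hX.1 _ hx
  have htx := hX.2 _ hx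
  have htsx := hX.2 _ hsx
  have hsplit : φ (T.t m * (T.t (T.s x) * (T.s x)⁻¹) * (T.t m)⁻¹) =
      φ (T.t m * (T.t (T.s x)) * (T.t m)⁻¹) - φ (T.t m * (T.s x) * (T.t m)⁻¹) := by
    rw [sub_eq_add_neg, ← addMap_inv hφ (hcj _ hsx _),
      ← hφ _ (hcj _ htsx _) _ (X.inv_mem (hcj _ hsx _))]
    congr 1; group
  have k := congrArg φ key2
  rw [hφ _ (X.inv_mem (hX.1 _ htx)) _ (hcj _ (hX.1 _ htsx) _),
    hφ _ (X.mul_mem (X.inv_mem htx) (hcj _ (X.mul_mem htsx (X.inv_mem hsx)) _)) _ (hcj _ hx _),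
    hφ _ (X.inv_mem htx) _ (hcj _ (X.mul_mem htsx (X.inv_mem hsx)) _), hsplit,
    addMap_inv hφ htx, addMap_inv hφ (hX.1 _ htx), hs _ htx, ht _ hx, hck _ (hX.1 _ htsx),
    hck _ hx, hcn _ htsx, hcn _ hsx] at k
  simp only [ss, tt] at k
  have a1 := h3 _ (hcj _ hsx m)
  have a2 := h3 _ (hcj _ htsx m)
  have a3 := h3 _ hx
  generalize φ (m * T.t (T.s x) * m⁻¹) = a at *
  generalize φ (m * (T.s x) * m⁻¹) = b at *
  generalize φ x = c at *
  have : a - b + c = (a + a + a) - (b + b + b) + (c + c + c) - (a + a + c - b + c - b) := by abel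
  rw [a1, a2, a3] at this
  have h4 : a + a + c - b + c - b = 0 := by
    have := sub_eq_zero.2 k
    rw [← neg_eq_zero, ← this]; abel
  rw [h4] at this
  rw [← sub_eq_zero, ← neg_neg (0 : V)]
  simp only [sub_zero, add_zero, neg_zero] at this ⊢
  rw [← this]; abel

theorem addMap_conj_sum (ht : ∀ x ∈ X, φ (T.t x) = - φ x) (g : G) {x : G} (hx : x ∈ X) :
    φ (T.m g * x * (T.m g)⁻¹) + φ ((T.m g)⁻¹ * x * T.m g) + φ x = 0 := by
  have hcj : ∀ y ∈ X, ∀ k : G, k * y * k⁻¹ ∈ X := fun y hy k => ‹X.Normal›.conj_mem y hy k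
  have h1 := addMap_conj_rotate hX hφ hs h3 ht g hx
  have h2 := fun y hy => addMap_conj_rotate hX hφ hs h3 ht g (x := y) hy
  have h3' := fun y hy => addMap_conj_rotate (T := T.swapZ) hX.swapZ hφ hs h3 (fun x hx => by
    change φ (T.s (T.t (T.s x))) = _
    rw [hs _ (hX.2 _ (hX.1 _ hx)), ht _ (hX.1 _ hx), hs _ hx, neg_neg]) g (x := y) hy
  have h4 := h2 _ (hX.1 _ (hX.2 _ hx))
  have h5 : φ (T.m g * T.s (T.t (T.s (T.s (T.s (T.t x))))) * (T.m g)⁻¹) =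
    φ (T.m g * T.s (T.s (T.t x)) * (T.m g)⁻¹) - φ (T.s (T.t x)) := h3' _ (hX.1 _ (hX.2 _ hx))
  simp only [ss, tt, tst] at h4 h5
  rw [← h5] at h4
  have e1 : φ (T.m g * T.s x * (T.m g)⁻¹) = - φ ((T.m g)⁻¹ * x * T.m g) := by
    have := hcj _ hx (T.m g)⁻¹
    rw [inv_inv] at this
    rw [← hs _ this]
    simp [s_m]
  rw [h4, h1, e1]
  abel

theorem addMap_conj_eq [Finite G] {p : ℕ} [hp : Fact p.Prime]
    (hc : ∀ x ∈ X, ∀ y ∈ X, x * y = y * x) (hpX : ¬ p ∣ Nat.card X) (hQ : IsPGroup p (G ⧸ X))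
    (ht : ∀ x ∈ X, φ (T.t x) = - φ x) (g : G) {x : G} (hx : x ∈ X) :
    φ (T.m g * x * (T.m g)⁻¹) = φ x := by
  have hcj : ∀ y ∈ X, ∀ k : G, k * y * k⁻¹ ∈ X := fun y hy k => ‹X.Normal›.conj_mem y hy k
  have hsum := fun y hy => addMap_conj_sum hX hφ hs h3 ht g (x := y) hy
  generalize T.m g = m at *
  have hpow : ∀ j : ℕ, φ (m ^ j * x * (m ^ j)⁻¹) = φ x + j • (φ (m * x * m⁻¹) - φ x) ∧
      φ (m ^ (j + 1) * x * (m ^ (j + 1))⁻¹) = φ x + (j + 1) • (φ (m * x * m⁻¹) - φ x) := by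
    intro j
    induction j with
    | zero => simp
    | succ j ih =>
      refine ⟨ih.2, ?_⟩
      have h := hsum _ (hcj _ hx (m ^ (j + 1)))
      have e1 : m * (m ^ (j + 1) * x * (m ^ (j + 1))⁻¹) * m⁻¹ =
        m ^ (j + 1 + 1) * x * (m ^ (j + 1 + 1))⁻¹ := by
        rw [pow_succ' m (j + 1)]; group
      have e2 : m⁻¹ * (m ^ (j + 1) * x * (m ^ (j + 1))⁻¹) * m = m ^ j * x * (m ^ j)⁻¹ := by
        rw [pow_succ' m j]; group
      rw [e1, e2, ih.1, ih.2] at h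
      have h0 := h3 _ (hcj _ hx (m ^ (j + 1)))
      rw [ih.2] at h0
      rw [← sub_eq_zero]
      have h' := congrArg₂ (· - ·) h h0
      simp only [sub_zero] at h'
      rw [← h']
      simp only [add_smul, one_smul]
      abel
  obtain ⟨k, hk⟩ := hQ (m : G ⧸ X)
  have hmk : m ^ p ^ k ∈ X := (QuotientGroup.eq_one_iff _).1 hk
  have h1 := (hpow (p ^ k)).1
  rw [hc _ hmk _ hx, mul_inv_cancel_right, left_eq_add] at h1
  have h2 : 3 • (φ (m * x * m⁻¹) - φ x) = 0 := by
    rw [smul_sub, sub_eq_zero]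
    have a := h3 _ (hcj _ hx m)
    have b := h3 _ hx
    rw [show (3 : ℕ) = 1 + 1 + 1 by norm_num]
    simp only [add_smul, one_smul]
    rw [a, b]
  by_cases hp3 : p = 3
  · have hz : ∀ y ∈ X, φ y = 0 := by
      intro y hy
      have hy3 : 3 • φ y = 0 := by
        have b := h3 _ hy
        rw [show (3 : ℕ) = 1 + 1 + 1 by norm_num]
        simpa only [add_smul, one_smul]
      have hyn : ∀ n : ℕ, φ (y ^ n) = n • φ y := by
        intro n
        induction n with
        | zero => simpa using addMap_one hφ
        | succ n ih => rw [pow_succ, hφ _ (X.pow_mem hy _) _ hy, ih, add_smul, one_smul]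
      have hN : Nat.card X • φ y = 0 := by
        rw [← hyn, ← addMap_one hφ]
        congr 1
        exact congrArg Subtype.val (pow_card_eq_one' (x := (⟨y, hy⟩ : X)))
      have : addOrderOf (φ y) = 1 := Nat.eq_one_of_dvd_coprimes
        ((Nat.Prime.coprime_iff_not_dvd hp.out).2 hpX)
        (addOrderOf_dvd_of_nsmul_eq_zero (by rwa [hp3])) (addOrderOf_dvd_of_nsmul_eq_zero hN)
      exact AddMonoid.addOrderOf_eq_one_iff.1 this
    rw [hz _ hx, hz _ (hcj _ hx m)]
  · have : addOrderOf (φ (m * x * m⁻¹) - φ x) = 1 := Nat.eq_one_of_dvd_coprimes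
      (((Nat.coprime_primes Nat.prime_three hp.out).2 (Ne.symm hp3)).pow_right k)
        (addOrderOf_dvd_of_nsmul_eq_zero h2) (addOrderOf_dvd_of_nsmul_eq_zero h1)
    rw [← sub_eq_zero]
    exact AddMonoid.addOrderOf_eq_one_iff.1 this

omit hs h3 hφ

theorem HasSylow.of_abelian [Finite G] {p : ℕ} [hp : Fact p.Prime]
    (ih : SylowBelow.{u} p (Nat.card G)) (hT : T.GT)
    (hc : ∀ x ∈ X, ∀ y ∈ X, x * y = y * x) (hpX : ¬ p ∣ Nat.card X) (hQ : IsPGroup p (G ⧸ X))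
    (hmin : ∀ Y ≤ X, Y.Normal → T.Inv Y → Y = ⊥ ∨ Y = X) : T.HasSylow p := by
  by_cases hcomm : T.comm = ⊤
  swap
  · exact HasSylow.of_comm_ne_top ih hT hcomm
  set S := (T.F ⊓ X) ⊔ (T.swap.F ⊓ X) with hS
  have hSX : S ≤ X := sup_le inf_le_right inf_le_right
  obtain ⟨V, _, φ, hφ, hφS⟩ := Subgroup.exists_addMap (S := S) hc
  have hs : ∀ x ∈ X, φ (T.s x) = - φ x := fun x hx => by
    rw [eq_neg_iff_add_eq_zero, ← hφ _ (hX.1 _ hx) _ hx, hφS _ (X.mul_mem (hX.1 _ hx) hx)]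
    refine Subgroup.mem_sup_left ⟨?_, X.mul_mem (hX.1 _ hx) hx⟩
    change T.s (T.s x * x) = T.s x * x
    rw [map_mul, ss, hc _ hx _ (hX.1 _ hx)]
  have ht : ∀ x ∈ X, φ (T.t x) = - φ x := fun x hx => by
    rw [eq_neg_iff_add_eq_zero, ← hφ _ (hX.2 _ hx) _ hx, hφS _ (X.mul_mem (hX.2 _ hx) hx)]
    refine Subgroup.mem_sup_right ⟨?_, X.mul_mem (hX.2 _ hx) hx⟩
    change T.t (T.t x * x) = T.t x * x
    rw [map_mul, tt, hc _ hx _ (hX.2 _ hx)]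
  have h3 : ∀ x ∈ X, φ x + φ x + φ x = 0 := fun x hx => by
    have hsx := hX.1 _ hx
    have htx := hX.2 _ hx
    have htsx := hX.2 _ hsx
    have hstx := hX.1 _ htx
    have hstsx := hX.1 _ htsx
    have e1 : φ x + φ x + φ x = φ (x * T.t (T.s x) * T.s (T.t x)) := by
      rw [hφ _ (X.mul_mem hx htsx) _ hstx, hφ _ hx _ htsx, ht _ hsx, hs _ htx, ht _ hx, hs _ hx,
        neg_neg]
    rw [e1, hφS _ (X.mul_mem (X.mul_mem hx htsx) hstx)]
    refine Subgroup.mem_sup_left ⟨?_, X.mul_mem (X.mul_mem hx htsx) hstx⟩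
    have key := T.tri x
    simp only [map_mul, map_inv, ss] at key
    let : CommGroup X :=
      { (inferInstance : Group X) with mul_comm := fun x y => Subtype.ext (hc x x.2 y y.2) }
    change T.s (x * T.t (T.s x) * T.s (T.t x)) = x * T.t (T.s x) * T.s (T.t x)
    simp only [map_mul, ss]
    have key' : (⟨x, hx⟩⁻¹ * ⟨T.s x, hsx⟩) * (⟨T.t (T.s x), htsx⟩⁻¹ * ⟨T.t x, htx⟩) *
        (⟨T.s (T.t x), hstx⟩⁻¹ * ⟨T.s (T.t (T.s x)), hstsx⟩) = (1 : X) := Subtype.ext key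
    have goal' : (⟨T.s x, hsx⟩ * ⟨T.s (T.t (T.s x)), hstsx⟩ * ⟨T.t x, htx⟩ : X) =
      ⟨x, hx⟩ * ⟨T.t (T.s x), htsx⟩ * ⟨T.s (T.t x), hstx⟩ := by
      rw [← mul_inv_eq_one, ← key']
      simp only [mul_inv_rev]
      generalize (⟨x, hx⟩ : X) = a
      generalize (⟨T.s x, hsx⟩ : X) = b
      generalize (⟨T.t (T.s x), htsx⟩ : X) = c
      generalize (⟨T.t x, htx⟩ : X) = d
      generalize (⟨T.s (T.t x), hstx⟩ : X) = e
      generalize (⟨T.s (T.t (T.s x)), hstsx⟩ : X) = f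
      ac_rfl
    exact congrArg Subtype.val goal'
  have hSi : T.Inv S := by
    constructor
    · intro x hx
      rw [← hφS _ (hX.1 _ (hSX hx)), hs _ (hSX hx), (hφS _ (hSX hx)).2 hx, neg_zero]
    · intro x hx
      rw [← hφS _ (hX.2 _ (hSX hx)), ht _ (hSX hx), (hφS _ (hSX hx)).2 hx, neg_zero]
  have hconj := fun g x hx => addMap_conj_eq hX hφ hs h3 hc hpX hQ ht g (x := x) hx
  have hSn : S.Normal := by
    rw [← Subgroup.normalizer_eq_top_iff, eq_top_iff, ← hcomm]
    refine comm_le hSi.normalizer fun g => ?_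
    rw [Subgroup.mem_normalizer_iff]
    intro h
    constructor
    · intro hh
      rw [← hφS _ (‹X.Normal›.conj_mem _ (hSX hh) _), hconj _ _ (hSX hh)]
      exact (hφS _ (hSX hh)).2 hh
    · intro hh
      have hhX : h ∈ X := by
        have := ‹X.Normal›.conj_mem _ (hSX hh) (T.m g)⁻¹
        simpa [mul_assoc] using this
      have h1 := (hφS _ (hSX hh)).2 hh
      rw [hconj _ _ hhX] at h1
      exact (hφS _ hhX).1 h1
  rcases hmin S hSX hSn hSi with h | h
  · refine HasSylow.of_centralized ih hT hpX hQ ?_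
    have hcent : T.Inv (Subgroup.centralizer (X : Set G)) := by
      constructor
      · intro g hg
        rw [Subgroup.mem_centralizer_iff] at hg ⊢
        intro x hx
        simpa using congrArg T.s (hg _ (hX.1 _ hx))
      · intro g hg
        rw [Subgroup.mem_centralizer_iff] at hg ⊢
        intro x hx
        simpa using congrArg T.t (hg _ (hX.2 _ hx))
    have htop : ∀ g : G, g ∈ Subgroup.centralizer (X : Set G) := by
      intro g
      have : g ∈ T.comm := hcomm ▸ trivial
      refine comm_le hcent (fun g => ?_) this
      rw [Subgroup.mem_centralizer_iff]
      intro x hx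
      have h1 := hconj g x hx
      have h2 : T.m g * x * (T.m g)⁻¹ ∈ X := ‹X.Normal›.conj_mem _ hx _
      have h4 : T.m g * x * (T.m g)⁻¹ * x⁻¹ ∈ S := by
        rw [← hφS _ (X.mul_mem h2 (X.inv_mem hx)), hφ _ h2 _ (X.inv_mem hx), addMap_inv hφ hx, h1,
          add_neg_cancel]
      rw [h, Subgroup.mem_bot, mul_inv_eq_one, mul_inv_eq_iff_eq_mul] at h4
      exact h4.symm
    intro g x hx
    exact (Subgroup.mem_centralizer_iff.1 (htop g) x hx).symm
  · refine HasSylow.of_factorization ih hT hpX hQ hX fun b hb => ?_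
    rw [← h, hS] at hb
    have hn : T.swap.F ⊓ X ≤ Subgroup.normalizer ((T.F ⊓ X : Subgroup G) : Set G) := by
      intro y hy
      rw [Subgroup.mem_normalizer_iff]
      intro k
      constructor
      · intro hk
        rwa [hc _ hy.2 _ hk.2, mul_inv_cancel_right]
      · intro hk
        have hkX : k ∈ X := by
          have := ‹X.Normal›.conj_mem _ hk.2 y⁻¹
          simpa [mul_assoc] using this
        rwa [hc _ hy.2 _ hkX, mul_inv_cancel_right] at hk
    rw [sup_comm, ← SetLike.mem_coe, Subgroup.coe_mul_of_left_le_normalizer_right _ _ hn] at hb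
    obtain ⟨c, hcc, a, ha, rfl⟩ := hb
    exact ⟨a, ha.2, c, hcc.2, ha.1, hcc.1, hc _ hcc.2 _ ha.2⟩

end Triality

/-- A minimal normal subgroup. -/
structure Subgroup.IsMinNormal {G : Type*} [Group G] (N : Subgroup G) : Prop where
  normal : N.Normal
  ne_bot : N ≠ ⊥
  eq_bot_or_eq : ∀ U ≤ N, U.Normal → U = ⊥ ∨ U = N

namespace Subgroup

variable {G : Type*} [Group G]

/-- The subgroup generated by the minimal normal subgroups. -/
def minSocle (G : Type*) [Group G] : Subgroup G := sSup {N : Subgroup G | N.IsMinNormal}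

namespace IsMinNormal

variable {N N' : Subgroup G}

theorem map (h : N.IsMinNormal) {f g : G →* G} (hfg : ∀ x, f (g x) = x) (hgf : ∀ x, g (f x) = x) :
    (N.map f).IsMinNormal where
  normal := h.normal.map f fun x => ⟨g x, hfg x⟩
  ne_bot e := h.ne_bot <| by
    rw [Subgroup.map_eq_bot_iff_of_injective _ (Function.LeftInverse.injective hgf)] at e
    exact e
  eq_bot_or_eq U hU hUn := by
    have e : (U.map g).map f = U := by
      rw [Subgroup.map_map]; convert U.map_id; ext; simp [hfg]
    have e' : (N.map f).map g = N := by
      rw [Subgroup.map_map]; convert N.map_id; ext; simp [hgf]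
    rcases h.eq_bot_or_eq (U.map g) ((Subgroup.map_mono hU).trans e'.le)
      (hUn.map g fun x => ⟨f x, hgf x⟩) with h1 | h1
    · left; rw [← e, h1, Subgroup.map_bot]
    · right; rw [← e, h1]

theorem le_or_disjoint (h : N.IsMinNormal) {B : Subgroup G} (hB : B.Normal) :
    N ≤ B ∨ Disjoint N B := by
  have := h.normal
  rcases h.eq_bot_or_eq (N ⊓ B) inf_le_left inferInstance with h | h
  · exact .inr (disjoint_iff.2 h)
  · exact .inl (inf_eq_left.1 h)

theorem commute_of_not_le (h : N.IsMinNormal) {B : Subgroup G} (hB : B.Normal) (hN : ¬ N ≤ B)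
    {x y : G} (hx : x ∈ N) (hy : y ∈ B) : Commute x y :=
  Subgroup.commute_of_normal_of_disjoint N B h.normal hB ((h.le_or_disjoint hB).resolve_left hN)
    x y hx hy

theorem commute_of_ne (h : N.IsMinNormal) (h' : N'.IsMinNormal) (hne : N ≠ N')
    {x y : G} (hx : x ∈ N) (hy : y ∈ N') : Commute x y := by
  refine h.commute_of_not_le h'.normal (fun hle => ?_) hx hy
  rcases h'.eq_bot_or_eq N hle h.normal with e | e
  · exact h.ne_bot e
  · exact hne e

variable (hsoc : minSocle G = ⊤)
include hsoc

theorem eq_top_of_le {K : Subgroup G} (h : N.IsMinNormal) (hN : N ≤ K)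
    (hK : ∀ x, (∀ y ∈ N, Commute y x) → x ∈ K) : K = ⊤ := by
  rw [eq_top_iff, ← hsoc]
  refine sSup_le fun N' h' => ?_
  by_cases e : N = N'
  · rwa [← e]
  · exact fun x hx => hK x fun y hy => h.commute_of_ne h' e hy hx

theorem eq_one_of_commute (hcen : Subgroup.center G = ⊥) (h : N.IsMinNormal) {x : G} (hx : x ∈ N)
    (hc : ∀ y ∈ N, Commute y x) : x = 1 := by
  have : Subgroup.centralizer {x} = ⊤ := h.eq_top_of_le hsoc
    (fun y hy => Subgroup.mem_centralizer_singleton_iff.2 (hc y hy))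
    (fun y hy => Subgroup.mem_centralizer_singleton_iff.2 (hy x hx).symm)
  rw [← Subgroup.mem_bot, ← hcen, Subgroup.mem_center_iff]
  intro g
  have hg : g ∈ Subgroup.centralizer {x} := this ▸ trivial
  exact (Subgroup.mem_centralizer_singleton_iff.1 hg)

theorem eq_bot_or_eq_of_le_normalizer (h : N.IsMinNormal) {U : Subgroup G} (hU : U ≤ N)
    (hn : N ≤ Subgroup.normalizer (U : Set G)) : U = ⊥ ∨ U = N := by
  refine h.eq_bot_or_eq U hU (Subgroup.normalizer_eq_top_iff.1 (h.eq_top_of_le hsoc hn ?_))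
  intro x hx
  rw [Subgroup.mem_normalizer_iff]
  intro k
  constructor
  · intro hk
    rwa [← (hx k (hU hk)).eq, mul_inv_cancel_right]
  · intro hk
    have h1 := (hx _ (hU hk)).eq
    have h2 : x * k * x⁻¹ = k := by
      rw [← mul_right_inj x, ← h1]; group
    rwa [h2] at hk

theorem commutator_eq (hcen : Subgroup.center G = ⊥) (h : N.IsMinNormal) : ⁅N, N⁆ = N := by
  have := h.normal
  refine (h.eq_bot_or_eq ⁅N, N⁆ (Subgroup.commutator_le_left N N) inferInstance).resolve_left
    fun e => h.ne_bot ?_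
  rw [Subgroup.commutator_eq_bot_iff_le_centralizer] at e
  rw [eq_bot_iff]
  intro x hx
  exact h.eq_one_of_commute hsoc hcen hx fun y hy => (Subgroup.mem_centralizer_iff.1 (e hx) y hy)

end IsMinNormal

variable {p : ℕ} {P₁ P₂ B₁ B₂ : Subgroup G}

theorem isPGroup_sup_of_commute (h1 : IsPGroup p P₁) (h2 : IsPGroup p P₂)
    (hc : ∀ x ∈ P₁, ∀ y ∈ P₂, Commute x y) : IsPGroup p (P₁ ⊔ P₂ : Subgroup G) := by
  refine h1.to_sup_of_normal_right' h2 fun x hx => ?_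
  rw [Subgroup.mem_normalizer_iff]
  intro k
  constructor
  · intro hk
    rwa [(hc x hx k hk).eq, mul_inv_cancel_right]
  · intro hk
    have h1 := (hc x hx _ hk).eq
    have h2 : x * k * x⁻¹ = k := by
      rw [← mul_right_inj x, h1]; group
    rwa [h2] at hk

theorem not_dvd_relIndex_sup [Finite G] (hp : p.Prime) [B₁.Normal] [B₂.Normal] (h1 : P₁ ≤ B₁)
    (h2 : P₂ ≤ B₂) (hi1 : ¬ p ∣ P₁.relIndex B₁) (hi2 : ¬ p ∣ P₂.relIndex B₂) :
    ¬ p ∣ (P₁ ⊔ P₂).relIndex (B₁ ⊔ B₂) := by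
  have e1 : P₁ ⊔ P₂ ⊔ B₂ = P₁ ⊔ B₂ := by rw [sup_assoc, sup_eq_right.2 h2]
  have e2 : P₁ ⊔ B₂ ⊔ B₁ = B₁ ⊔ B₂ := by
    rw [sup_right_comm, sup_eq_right.2 h1]
  rw [← Subgroup.relIndex_mul_relIndex (P₁ ⊔ P₂) (P₁ ⊔ B₂) (B₁ ⊔ B₂) (sup_le_sup le_rfl h2)
    (sup_le_sup h1 le_rfl), hp.dvd_mul, not_or, ← e1, relIndex_sup_of_normal, e1, ← e2,
    relIndex_sup_of_normal]
  exact ⟨fun h => hi2 (h.trans (relIndex_dvd_of_le_left _ le_sup_right)),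
    fun h => hi1 (h.trans (relIndex_dvd_of_le_left _ le_sup_left))⟩

theorem exists_isPGroup_not_dvd_relIndex [Fact p.Prime] [Finite G] (N : Subgroup G) :
    ∃ P ≤ N, IsPGroup p P ∧ ¬ p ∣ P.relIndex N := by
  let S : Sylow p N := default
  refine ⟨(S : Subgroup N).map N.subtype, Subgroup.map_subtype_le _, S.2.map _, ?_⟩
  have := S.not_dvd_index
  rwa [Subgroup.relIndex, Subgroup.subgroupOf,
    Subgroup.comap_map_eq_self_of_injective N.subtype_injective]

end Subgroup

namespace Triality

variable {G : Type u} [Group G] {T : Triality G}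

/-- An invariant normal subgroup with an invariant Sylow `p`-subgroup and a factorization into
the fixed points of `s` and those of `t`. -/
structure Good (T : Triality G) (p : ℕ) (B : Subgroup G) : Prop where
  normal : B.Normal
  inv : T.Inv B
  sylow : ∃ P ≤ B, IsPGroup p P ∧ T.Inv P ∧ ¬ p ∣ P.relIndex B
  fac : ∀ b ∈ B, ∃ a ∈ B, ∃ c ∈ B, T.s a = a ∧ T.t c = c ∧ b = a * c

theorem Good.sup [Finite G] {p : ℕ} (hp : p.Prime) {B C : Subgroup G} (hB : T.Good p B)
    (hC : T.Good p C)
    (hc : ∀ x ∈ B, ∀ y ∈ C, Commute x y) : T.Good p (B ⊔ C) := by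
  have := hB.normal
  have := hC.normal
  refine ⟨inferInstance, hB.inv.sup hC.inv, ?_, ?_⟩
  · obtain ⟨P, hP, hPp, hPi, hPd⟩ := hB.sylow
    obtain ⟨Q, hQ, hQp, hQi, hQd⟩ := hC.sylow
    exact ⟨P ⊔ Q, sup_le_sup hP hQ,
      Subgroup.isPGroup_sup_of_commute hPp hQp fun x hx y hy => hc x (hP hx) y (hQ hy),
      hPi.sup hQi, Subgroup.not_dvd_relIndex_sup hp hP hQ hPd hQd⟩
  · intro b hb
    rw [Subgroup.mem_sup_of_normal_right] at hb
    obtain ⟨x, hx, y, hy, rfl⟩ := hb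
    obtain ⟨a, ha, c, hcB, h1, h2, rfl⟩ := hB.fac x hx
    obtain ⟨a', ha', c', hcB', h1', h2', rfl⟩ := hC.fac y hy
    refine ⟨a * a', Subgroup.mul_mem_sup ha ha', c * c', Subgroup.mul_mem_sup hcB hcB',
      by rw [map_mul, h1, h1'], by rw [map_mul, h2, h2'], ?_⟩
    have := (hc c hcB a' ha').eq
    simp only [mul_assoc]
    rw [← mul_assoc c, this, mul_assoc]

theorem t_eq_of_s_eq {K : Subgroup G} (hK : T.Inv K) (h : ∀ x ∈ K, T.s x = x) {x : G} (hx : x ∈ K) :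
    T.t x = x := by
  have h3 := T.tst x
  rw [h _ hx, h _ (hK.2 _ hx), T.tt] at h3
  exact h3.symm

end Triality

namespace Triality

variable {G : Type u} [Group G] {T : Triality G} {p : ℕ}

theorem Inv.of_map_le {K : Subgroup G} (hs : K.map T.s ≤ K) (ht : K.map T.t ≤ K) : T.Inv K :=
  ⟨fun x hx => hs ⟨x, hx, rfl⟩, fun x hx => ht ⟨x, hx, rfl⟩⟩

theorem Inv.map_s_le {K L : Subgroup G} (hK : T.Inv K) (h : L ≤ K) : L.map T.s ≤ K := by
  rintro _ ⟨x, hx, rfl⟩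
  exact hK.1 _ (h hx)

theorem Inv.map_t_le {K L : Subgroup G} (hK : T.Inv K) (h : L ≤ K) : L.map T.t ≤ K := by
  rintro _ ⟨x, hx, rfl⟩
  exact hK.2 _ (h hx)

theorem _root_.Subgroup.IsMinNormal.map_s {N : Subgroup G} (h : N.IsMinNormal) :
    (N.map T.s).IsMinNormal := h.map T.ss T.ss

theorem _root_.Subgroup.IsMinNormal.map_t {N : Subgroup G} (h : N.IsMinNormal) :
    (N.map T.t).IsMinNormal := h.map T.tt T.tt

theorem _root_.Subgroup.commute_of_mem_sup {A B C : Subgroup G}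
    (hA : ∀ x ∈ A, ∀ y ∈ C, Commute x y) (hB : ∀ x ∈ B, ∀ y ∈ C, Commute x y) :
    ∀ x ∈ A ⊔ B, ∀ y ∈ C, Commute x y := by
  have : A ⊔ B ≤ Subgroup.centralizer (C : Set G) :=
    sup_le (fun x hx => Subgroup.mem_centralizer_iff.2 fun y hy => (hA x hx y hy).symm)
      (fun x hx => Subgroup.mem_centralizer_iff.2 fun y hy => (hB x hx y hy).symm)
  exact fun x hx y hy => (Subgroup.mem_centralizer_iff.1 (this hx) y hy).symm

/-- An invariant normal subgroup which is fixed pointwise by `s` is good. -/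
theorem Good.of_fixed [Fact p.Prime] [Finite G] {B : Subgroup G} (hB : B.Normal) (hi : T.Inv B)
    (hfix : ∀ x ∈ B, T.s x = x) : T.Good p B := by
  refine ⟨hB, hi, ?_, fun b hb => ⟨b, hb, 1, B.one_mem, hfix b hb, map_one _, (mul_one b).symm⟩⟩
  obtain ⟨P, hP, hPp, hd⟩ := Subgroup.exists_isPGroup_not_dvd_relIndex (p := p) B
  refine ⟨P, hP, hPp, ⟨fun x hx => ?_, fun x hx => ?_⟩, hd⟩
  · rwa [hfix x (hP hx)]
  · rwa [t_eq_of_s_eq hi hfix (hP hx)]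

variable (hsoc : Subgroup.minSocle G = ⊤) (hcen : Subgroup.center G = ⊥)
include hsoc hcen

theorem exists_good_of_map_eq [Fact p.Prime] [Finite G] (hT : T.GT) {N : Subgroup G}
    (h : N.IsMinNormal)
    (hst : N.map T.s = N.map T.t) :
    ∃ B, T.Good p B ∧ N ≤ B ∧ ∀ K, T.Inv K → N ≤ K → B ≤ K := by
  have hNn := h.normal
  have hsn := (h.map_s (T := T)).normal
  set B := N ⊔ N.map T.s with hBdef
  have hNB : N ≤ B := le_sup_left
  have hi : T.Inv B := by
    apply Inv.of_map_le
    · rw [hBdef, Subgroup.map_sup, map_ss, sup_comm]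
    · rw [hBdef, Subgroup.map_sup, ← hst]
      conv_lhs => rw [hst, map_tt, ← hst, sup_comm]
  refine ⟨B, ?_, hNB, fun K hK hN => sup_le hN (hK.map_s_le hN)⟩
  by_cases hfix : ∀ x ∈ B, T.s x = x
  · exact Good.of_fixed inferInstance hi hfix
  exfalso
  push Not at hfix
  obtain ⟨Y, hY, hYi, hC, g, hg, hgY⟩ := hT B hi hfix
  have hnorm : ∀ y ∈ N, ∀ k ∈ T.G1 B, y * k * y⁻¹ ∈ T.G1 B := fun y hy k hk =>
    (Subgroup.mem_normalizer_iff.1 (le_normalizer_G1 B (hNB hy)) k).1 hk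
  have hNG : N ≤ T.G1 B := by
    have hU := h.eq_bot_or_eq_of_le_normalizer hsoc (U := T.G1 B ⊓ N) inf_le_right fun x hx => by
      rw [Subgroup.mem_normalizer_iff]
      intro k
      have h1 := Subgroup.mem_normalizer_iff.1 (le_normalizer_G1 (T := T) B (hNB hx)) k
      have h2 := Subgroup.mem_normalizer_iff.1 (Subgroup.le_normalizer (H := N) hx) k
      exact and_congr h1 h2
    refine hU.elim (fun e => ?_) inf_eq_right.1
    exfalso
    have hU1 : ∀ x ∈ T.G1 B, x ∈ N → x = 1 := fun x h1 h2 =>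
      Subgroup.mem_bot.1 (e ▸ (⟨h1, h2⟩ : x ∈ T.G1 B ⊓ N))
    by_cases hs : N.map T.s = N
    · obtain ⟨x, hx, hne⟩ := hfix
      rw [hBdef, hs, sup_idem] at hx
      refine hne (m_eq_one T |>.1 (hU1 _ (m_mem_G1 (hNB hx)) ?_))
      exact N.mul_mem (N.inv_mem hx) (hs.le ⟨x, hx, rfl⟩)
    · refine h.ne_bot ((Subgroup.eq_bot_iff_forall _).2 fun x hx =>
        h.eq_one_of_commute hsoc hcen hx fun y hy => ?_)
      have h1 : Commute y (T.s x) := h.commute_of_ne h.map_s (Ne.symm hs) hy ⟨x, hx, rfl⟩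
      have h2 := (T.G1 B).mul_mem (hnorm y hy _ (m_mem_G1 (hNB hx)))
        ((T.G1 B).inv_mem (m_mem_G1 (T := T) (hNB hx)))
      have e2 : y * T.m x * y⁻¹ * (T.m x)⁻¹ = y * x⁻¹ * y⁻¹ * x := by
        have : T.s x * y⁻¹ * (T.s x)⁻¹ = y⁻¹ := by rw [← h1.inv_left.eq, mul_inv_cancel_right]
        calc _ = y * x⁻¹ * (T.s x * y⁻¹ * (T.s x)⁻¹) * x := by simp only [m]; group
          _ = _ := by rw [this]
      rw [e2] at h2
      have h3 := hU1 _ h2 (N.mul_mem (N.mul_mem (N.mul_mem hy (N.inv_mem hx)) (N.inv_mem hy)) hx)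
      have h4 : y * x⁻¹ = x⁻¹ * y := by
        rw [← mul_left_inj (y⁻¹ * x), ← mul_assoc, h3]; group
      exact (Commute.inv_right_iff (a := y) (b := x)).1 h4
  have hst' : (N.map T.s).map T.t = N := by rw [hst, map_tt]
  have hts' : (N.map T.t).map T.s = N := by rw [← hst, map_ss]
  have h1 : N ≤ (T.G1 B).map T.t := by
    conv_lhs => rw [← hst']
    exact Subgroup.map_mono ((Subgroup.map_mono hNG).trans (s_G1 B))
  have h2 : N ≤ ((T.G1 B).map T.t).map T.s := by
    conv_lhs => rw [← hts']
    exact Subgroup.map_mono (Subgroup.map_mono hNG)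
  have h3 : N ≤ T.tripleComm B := by
    have e := h.commutator_eq hsoc hcen
    have e2 : ⁅⁅N, N⁆, N⁆ = N := by rw [e, e]
    exact e2.symm.le.trans (Subgroup.commutator_mono (Subgroup.commutator_mono hNG h1) h2)
  have hNY := h3.trans hC
  exact hgY ((sup_le hNY (hYi.map_s_le hNY) : B ≤ Y) (hi.m_mem hg))

omit hsoc hcen in
theorem inv_sup_map {K : Subgroup G} (hK : K.map T.s = K) :
    T.Inv (K ⊔ K.map T.t ⊔ (K.map T.t).map T.s) := by
  apply Inv.of_map_le
  · rw [Subgroup.map_sup, Subgroup.map_sup, map_ss, hK, sup_right_comm]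
  · rw [Subgroup.map_sup, Subgroup.map_sup, map_tt, map_tst, hK, sup_comm (K.map T.t)]

omit hsoc hcen in
theorem exists_good_of_fixed [hp : Fact p.Prime] [Finite G] {N : Subgroup G} (h : N.IsMinNormal)
    (hs : ∀ x ∈ N, T.s x = x) (ht : N.map T.t ≠ N) :
    ∃ B, T.Good p B ∧ N ≤ B ∧ ∀ K, T.Inv K → N ≤ K → B ≤ K := by
  have hfix : ∀ K ≤ N, K.map T.s = K := by
    intro K hK
    ext x
    constructor
    · rintro ⟨y, hy, rfl⟩
      rwa [hs y (hK hy)]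
    · exact fun hx => ⟨x, hx, hs x (hK hx)⟩
  have hNs := hfix N le_rfl
  have h1 := h.map_t (T := T)
  have h2 := h1.map_s (T := T)
  have n0 := h.normal
  have n1 := h1.normal
  have n2 := h2.normal
  have ne2 : N ≠ (N.map T.t).map T.s := by
    intro e
    have := congrArg (Subgroup.map T.s) e
    rw [map_ss, hNs] at this
    exact ht this.symm
  have ne12 : N.map T.t ≠ (N.map T.t).map T.s := by
    intro e
    have := congrArg (Subgroup.map T.t) e
    rw [map_tt, map_tst, hNs] at this
    exact ne2 this
  have c01 : ∀ x ∈ N, ∀ y ∈ N.map T.t, Commute x y :=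
    fun x hx y hy => h.commute_of_ne h1 ht.symm hx hy
  have c02 : ∀ x ∈ N, ∀ y ∈ (N.map T.t).map T.s, Commute x y :=
    fun x hx y hy => h.commute_of_ne h2 ne2 hx hy
  have c12 : ∀ x ∈ N.map T.t, ∀ y ∈ (N.map T.t).map T.s, Commute x y :=
    fun x hx y hy => h1.commute_of_ne h2 ne12 hx hy
  have c3 := Subgroup.commute_of_mem_sup c02 c12
  have hi := inv_sup_map hNs
  refine ⟨N ⊔ N.map T.t ⊔ (N.map T.t).map T.s, ⟨inferInstance, hi, ?_, ?_⟩,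
    le_sup_of_le_left le_sup_left, fun K hK hN =>
      sup_le (sup_le hN (hK.map_t_le hN)) (hK.map_s_le (hK.map_t_le hN))⟩
  · obtain ⟨P, hP, hPp, hd⟩ := Subgroup.exists_isPGroup_not_dvd_relIndex (p := p) N
    have hP1 : P.map T.t ≤ N.map T.t := Subgroup.map_mono hP
    have hP2 : (P.map T.t).map T.s ≤ (N.map T.t).map T.s := Subgroup.map_mono hP1
    have hd1 : ¬ p ∣ (P.map T.t).relIndex (N.map T.t) := by
      rwa [Subgroup.relIndex_map_map_of_injective _ _ T.tE.injective]
    have hd2 : ¬ p ∣ ((P.map T.t).map T.s).relIndex ((N.map T.t).map T.s) := by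
      rwa [Subgroup.relIndex_map_map_of_injective _ _ T.sE.injective]
    refine ⟨P ⊔ P.map T.t ⊔ (P.map T.t).map T.s, sup_le_sup (sup_le_sup hP hP1) hP2, ?_,
      inv_sup_map (hfix P hP), ?_⟩
    · refine Subgroup.isPGroup_sup_of_commute (Subgroup.isPGroup_sup_of_commute hPp (hPp.map _)
        fun x hx y hy => c01 x (hP hx) y (hP1 hy)) ((hPp.map _).map _) fun x hx y hy =>
          c3 x (sup_le_sup hP hP1 hx) y (hP2 hy)
    · exact Subgroup.not_dvd_relIndex_sup hp.1 (sup_le_sup hP hP1) hP2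
        (Subgroup.not_dvd_relIndex_sup hp.1 hP hP1 hd hd1) hd2
  · intro b hb
    rw [Subgroup.mem_sup_of_normal_right] at hb
    obtain ⟨b, hb, _, ⟨_, ⟨w, hw, rfl⟩, rfl⟩, rfl⟩ := hb
    rw [Subgroup.mem_sup_of_normal_right] at hb
    obtain ⟨x, hx, _, ⟨y, hy, rfl⟩, rfl⟩ := hb
    have m0 : ∀ {x}, x ∈ N → x ∈ N ⊔ N.map T.t ⊔ (N.map T.t).map T.s :=
      fun hx => Subgroup.mem_sup_left (Subgroup.mem_sup_left hx)
    refine ⟨x * T.t y * T.s (T.t y), mul_mem (mul_mem (m0 hx) (hi.2 _ (m0 hy)))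
      (hi.1 _ (hi.2 _ (m0 hy))), T.s (T.t (y⁻¹ * w)),
      hi.1 _ (hi.2 _ (m0 (mul_mem (inv_mem hy) hw))), ?_, ?_, ?_⟩
    · simp only [map_mul, ss, hs x hx, mul_assoc]
      rw [(c12 _ ⟨y, hy, rfl⟩ _ ⟨_, ⟨y, hy, rfl⟩, rfl⟩).eq]
    · rw [tst, hs _ (mul_mem (inv_mem hy) hw)]
    · simp only [map_mul, map_inv]; group

theorem fixed_of_map_eq {N : Subgroup G} (h : N.IsMinNormal) (hs : N.map T.s = N)
    (ht : N.map T.t ≠ N) {x : G} (hx : x ∈ N) : T.s x = x := by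
  have h1 := h.map_t (T := T)
  have h2 := h1.map_s (T := T)
  have hu : T.m x ∈ N := N.mul_mem (N.inv_mem hx) (hs.le ⟨x, hx, rfl⟩)
  have ne2 : N ≠ (N.map T.t).map T.s := by
    intro e
    have := congrArg (Subgroup.map T.s) e
    rw [map_ss, hs] at this
    exact ht this.symm
  rw [← m_eq_one]
  refine h.eq_one_of_commute hsoc hcen hu fun y hy => ?_
  have e := T.tri_m x
  rw [mul_assoc, mul_eq_one_iff_eq_inv] at e
  rw [e]
  refine (Commute.mul_right ?_ ?_).inv_right
  · exact h.commute_of_ne h1 ht.symm hy ⟨_, hs.le ⟨_, hu, rfl⟩, rfl⟩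
  · exact h.commute_of_ne h2 ne2 hy ⟨_, ⟨_, hu, rfl⟩, rfl⟩

theorem exists_fixed {N : Subgroup G} (h : N.IsMinNormal) (hr : N.map T.s ≠ N.map T.t) :
    ∃ N' : Subgroup G, N'.IsMinNormal ∧ (∀ x ∈ N', T.s x = x) ∧ N'.map T.t ≠ N' ∧
      ∀ K, T.Inv K → (N ≤ K ↔ N' ≤ K) := by
  have fin : ∀ N' : Subgroup G, N'.IsMinNormal → N'.map T.s = N' → N'.map T.t ≠ N' →
      (∀ K, T.Inv K → (N ≤ K ↔ N' ≤ K)) → ∃ N' : Subgroup G, N'.IsMinNormal ∧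
      (∀ x ∈ N', T.s x = x) ∧ N'.map T.t ≠ N' ∧ ∀ K, T.Inv K → (N ≤ K ↔ N' ≤ K) :=
    fun N' h' hs ht hK => ⟨N', h', fun x hx => fixed_of_map_eq hsoc hcen h' hs ht hx, ht, hK⟩
  by_cases h0 : N.map T.s = N
  · exact fin N h h0 (fun e => hr (h0.trans e.symm)) fun K _ => Iff.rfl
  by_cases h1 : N.map T.s = (N.map T.s).map T.t
  · have e1 : (N.map T.t).map T.s = N.map T.t := by
      have := congrArg (Subgroup.map T.s) h1
      rw [map_ss, ← map_tst] at this
      conv_rhs => rw [this, map_tt]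
    refine fin (N.map T.t) h.map_t e1 ?_ fun K hK =>
      ⟨hK.map_t_le, fun h => map_tt (T := T) N ▸ hK.map_t_le h⟩
    rw [map_tt]
    intro e
    rw [← e] at e1
    exact h0 e1
  by_cases h2 : N.map T.t = N
  · refine fin ((N.map T.s).map T.t) h.map_s.map_t ?_ ?_ fun K hK =>
      ⟨fun h => hK.map_t_le (hK.map_s_le h), fun h => ?_⟩
    · rw [← map_tst, h2]
    · rwa [map_tt]
    · rw [← map_ss (T := T) N, ← map_tt (T := T) (N.map T.s)]
      exact hK.map_s_le (hK.map_t_le h)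
  exfalso
  have ne1 : N ≠ (N.map T.s).map T.t := by
    intro e
    have := congrArg (Subgroup.map T.t) e
    rw [map_tt] at this
    exact hr this.symm
  have ne2 : N ≠ (N.map T.t).map T.s := by
    intro e
    have := congrArg (Subgroup.map T.s) e
    rw [map_ss] at this
    exact hr this
  have ne3 : N ≠ ((N.map T.s).map T.t).map T.s := by
    intro e
    have := congrArg (Subgroup.map T.s) e
    rw [map_ss] at this
    exact h1 this
  refine h.ne_bot ((Subgroup.eq_bot_iff_forall _).2 fun x hx =>
    h.eq_one_of_commute hsoc hcen hx fun y hy => ?_)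
  have e := T.tri x
  simp only [map_mul, map_inv, ss, mul_assoc] at e
  rw [inv_mul_eq_one] at e
  rw [e]
  have k1 : Commute y (T.s x) := h.commute_of_ne h.map_s (Ne.symm h0) hy ⟨x, hx, rfl⟩
  have k2 : Commute y (T.t (T.s x)) :=
    h.commute_of_ne h.map_s.map_t ne1 hy ⟨_, ⟨x, hx, rfl⟩, rfl⟩
  have k3 : Commute y (T.t x) := h.commute_of_ne h.map_t (Ne.symm h2) hy ⟨x, hx, rfl⟩
  have k4 : Commute y (T.s (T.t x)) :=
    h.commute_of_ne h.map_t.map_s ne2 hy ⟨_, ⟨x, hx, rfl⟩, rfl⟩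
  have k5 : Commute y (T.s (T.t (T.s x))) :=
    h.commute_of_ne h.map_s.map_t.map_s ne3 hy ⟨_, ⟨_, ⟨x, hx, rfl⟩, rfl⟩, rfl⟩
  exact k1.mul_right (k2.inv_right.mul_right (k3.mul_right (k4.inv_right.mul_right k5)))

theorem exists_good [Fact p.Prime] [Finite G] (hT : T.GT) {N : Subgroup G} (h : N.IsMinNormal) :
    ∃ B, T.Good p B ∧ N ≤ B ∧ ∀ K, T.Inv K → N ≤ K → B ≤ K := by
  by_cases hr : N.map T.s = N.map T.t
  · exact exists_good_of_map_eq hsoc hcen hT h hr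
  · obtain ⟨N', h', hs, ht, hK⟩ := exists_fixed hsoc hcen h hr
    obtain ⟨B, hB, hN, hm⟩ := exists_good_of_fixed (p := p) h' hs ht
    exact ⟨B, hB, (hK B hB.inv).2 hN, fun K hKi hNK => hm K hKi ((hK K hKi).1 hNK)⟩

theorem good_top [hp : Fact p.Prime] [Finite G] (hT : T.GT) : T.Good p ⊤ := by
  have h0 : T.Good p (⊥ : Subgroup G) := Good.of_fixed inferInstance Inv.bot fun x hx => by
    rw [Subgroup.mem_bot.1 hx, map_one]
  obtain ⟨B, hB⟩ := (Set.toFinite {B : Subgroup G | T.Good p B}).exists_maximal ⟨_, h0⟩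
  have hBn := hB.1.normal
  suffices B = ⊤ from this ▸ hB.1
  rw [eq_top_iff, ← hsoc]
  refine sSup_le fun N hN => ?_
  by_contra hle
  obtain ⟨C, hC, hNC, hCm⟩ := exists_good (p := p) hsoc hcen hT hN
  have hci : T.Inv (Subgroup.centralizer (B : Set G)) := by
    constructor
    · intro x hx
      rw [Subgroup.mem_centralizer_iff] at hx ⊢
      intro y hy
      simpa using congrArg T.s (hx _ (hB.1.inv.1 y hy))
    · intro x hx
      rw [Subgroup.mem_centralizer_iff] at hx ⊢
      intro y hy
      simpa using congrArg T.t (hx _ (hB.1.inv.2 y hy))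
  have hCB := hCm _ hci fun x hx => Subgroup.mem_centralizer_iff.2 fun y hy =>
    (hN.commute_of_not_le hBn hle hx hy).symm.eq
  have hs := hB.1.sup hp.1 hC fun x hx y hy => Subgroup.mem_centralizer_iff.1 (hCB hy) x hx
  exact hle (hNC.trans (le_sup_right.trans (hB.2 hs le_sup_left)))

end Triality

theorem Subgroup.exists_isMinNormal (G : Type*) [Group G] [Finite G] [Nontrivial G] :
    ∃ N : Subgroup G, N.IsMinNormal := by
  obtain ⟨N, hN⟩ := (Set.toFinite {N : Subgroup G | N.Normal ∧ N ≠ ⊥}).exists_minimal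
    ⟨⊤, inferInstance, top_ne_bot⟩
  refine ⟨N, hN.1.1, hN.1.2, fun U hU hUn => ?_⟩
  by_cases h : U = ⊥
  · exact .inl h
  · exact .inr (le_antisymm hU (hN.2 ⟨hUn, h⟩ hU))

instance Subgroup.characteristic_minSocle (G : Type*) [Group G] :
    (Subgroup.minSocle G).Characteristic := by
  rw [Subgroup.characteristic_iff_map_le]
  intro φ
  rw [Subgroup.map_le_iff_le_comap]
  refine sSup_le fun N hN => ?_
  rw [← Subgroup.map_le_iff_le_comap]
  exact le_sSup (Subgroup.IsMinNormal.map hN (f := φ.toMonoidHom) (g := φ.symm.toMonoidHom)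
    φ.apply_symm_apply φ.symm_apply_apply)

namespace Triality

/-- A finite group of group type with triality has an invariant `p`-subgroup whose set of cosets
modulo the fixed points of `s` is as large as possible. -/
theorem GT.hasSylow {p : ℕ} [hp : Fact p.Prime] {G : Type u} [Group G] [Finite G] (T : Triality G)
    (hT : T.GT) : T.HasSylow p := by
  induction hn : Nat.card G using Nat.strong_induction_on generalizing G with | _ n IH
  subst hn
  have ih : SylowBelow.{u} p (Nat.card G) := fun H _ _ T' hT' hlt => IH _ hlt T' hT' rfl
  by_cases hd : p ∣ T.F.index
  swap
  · exact HasSylow.of_not_dvd hd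
  have hG : Nontrivial G := by
    by_contra hG
    rw [not_nontrivial_iff_subsingleton] at hG
    have : T.F = ⊤ := Subsingleton.elim _ _
    rw [this, Subgroup.index_top] at hd
    exact hp.out.one_lt.ne' (Nat.dvd_one.1 hd)
  obtain ⟨X, hX⟩ := (Set.toFinite {N : Subgroup G | N.Normal ∧ T.Inv N ∧ N ≠ ⊥}).exists_minimal
    ⟨⊤, inferInstance, Inv.top, top_ne_bot⟩
  obtain ⟨⟨hXn, hXi, hX0⟩, hXm⟩ := hX
  have hmin : ∀ Y ≤ X, Y.Normal → T.Inv Y → Y = ⊥ ∨ Y = X := fun Y hY hYn hYi => by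
    by_cases h : Y = ⊥
    · exact .inl h
    · exact .inr (le_antisymm hY (hXm ⟨hYn, hYi, h⟩ hY))
  have hchar : ∀ K : Subgroup X, K.Characteristic → K = ⊥ ∨ K = ⊤ := fun K hK => by
    rcases hmin (K.map X.subtype) (Subgroup.map_subtype_le K)
      (ConjAct.normal_of_characteristic_of_normal) ((T.restrict_inv hXi).1 Inv.of_characteristic)
      with h | h
    · exact .inl ((Subgroup.map_eq_bot_iff_of_injective _ X.subtype_injective).1 h)
    · right
      rw [eq_top_iff]
      intro x _
      obtain ⟨y, hy, e⟩ := h.symm.le x.2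
      rwa [← Subtype.ext e]
  have hXnt : Nontrivial X := (Subgroup.nontrivial_iff_ne_bot X).2 hX0
  have hnp : ∀ R : Subgroup X, IsPGroup p R → R ≠ ⊥ → (T.restrict hXi).Inv R → ¬ p ∣ R.index →
      T.HasSylow p := fun R hR hR0 hRi hRd => by
    refine HasSylow.of_normal_p ih hT (Subgroup.map_subtype_le R) (hR.map _) ?_
      ((T.restrict_inv hXi).1 hRi) ?_
    · rwa [Ne, Subgroup.map_eq_bot_iff_of_injective _ X.subtype_injective]
    · rwa [Subgroup.relIndex, Subgroup.subgroupOf,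
        Subgroup.comap_map_eq_self_of_injective X.subtype_injective]
  have hQ := HasSylow.or_isPGroup_quot ih hT hXi hX0
  by_cases hc : Subgroup.center X = ⊤
  · let R : Sylow p X := default
    have hcomm : ∀ x y : X, x * y = y * x := fun x y =>
      (Subgroup.mem_center_iff.1 (hc ▸ Subgroup.mem_top y) x)
    have hRn : (R : Subgroup X).Normal := ⟨fun a ha g => by rwa [hcomm g, mul_inv_cancel_right]⟩
    have := R.characteristic_of_normal hRn
    by_cases hR : (R : Subgroup X) = ⊥
    · refine hQ.elim id fun hQ => HasSylow.of_abelian hXi ih hT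
        (fun x hx y hy => congrArg Subtype.val (hcomm ⟨x, hx⟩ ⟨y, hy⟩)) ?_ hQ hmin
      have := R.not_dvd_index
      rwa [hR, Subgroup.index_bot] at this
    · exact hnp R R.2 hR Inv.of_characteristic R.not_dvd_index
  · have hcen := (hchar (Subgroup.center X) inferInstance).resolve_right hc
    have hsoc := (hchar (Subgroup.minSocle X) inferInstance).resolve_left fun e => by
      obtain ⟨N, hN⟩ := Subgroup.exists_isMinNormal X
      exact hN.ne_bot (le_bot_iff.1 (e ▸ le_sSup hN))
    have hgood := good_top (p := p) hsoc hcen (hT.restrict hXi)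
    obtain ⟨P, -, hPp, hPi, hPd⟩ := hgood.sylow
    rw [Subgroup.relIndex_top_right] at hPd
    by_cases hP : P = ⊥
    · refine hQ.elim id fun hQ => HasSylow.of_factorization ih hT ?_ hQ hXi ?_
      · rwa [hP, Subgroup.index_bot] at hPd
      · intro b hb
        obtain ⟨a, -, c, -, ha, hc, e⟩ := hgood.fac ⟨b, hb⟩ trivial
        exact ⟨a, a.2, c, c.2, congrArg Subtype.val ha, congrArg Subtype.val hc,
          congrArg Subtype.val e⟩
    · exact hnp P hPp hP hPi hPd

end Triality

namespace MoufangLoop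

variable {M : Type u} [MoufangLoop M]

theorem mul_left_cancel' {a x y : M} (h : a * x = a * y) : x = y :=
  (existsUnique_mul_left a (a * y)).unique h rfl

theorem mul_right_cancel' {a x y : M} (h : x * a = y * a) : x = y :=
  (existsUnique_mul_right a (y * a)).unique h rfl

noncomputable instance : Inv M := ⟨fun x => lsol x 1⟩

theorem mul_inv (x : M) : x * x⁻¹ = 1 := mul_lsol x 1

theorem mul_inv_mul (x z : M) : x * (x⁻¹ * z) = z := by
  have h := moufang x x⁻¹ z
  rw [mul_inv, one_mul] at h
  exact (mul_right_cancel' h).symm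

theorem inv_mul (x : M) : x⁻¹ * x = 1 :=
  mul_left_cancel' (a := x) (by rw [mul_inv_mul, mul_one])

theorem inv_mul_mul (x z : M) : x⁻¹ * (x * z) = z :=
  mul_left_cancel' (a := x) (mul_inv_mul x _)

theorem mul_inv_cancel_mul (y x : M) : (y * x⁻¹) * x = y := by
  have hf : ∀ z : M, x * (z * x) = (x * z) * x := fun z => by
    have h := moufang x 1 z
    rwa [mul_one, one_mul] at h
  have h := moufang x y x⁻¹
  rw [inv_mul, mul_one, ← hf] at h
  exact (mul_left_cancel' h).symm

theorem mul_mul_inv (y x : M) : (y * x) * x⁻¹ = y :=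
  mul_right_cancel' (a := x) (mul_inv_cancel_mul _ x)

theorem inv_inv' (x : M) : x⁻¹⁻¹ = x :=
  mul_left_cancel' (a := x⁻¹) (by rw [mul_inv, inv_mul])

theorem inv_eq_iff {x y : M} : x⁻¹ = y ↔ x = y⁻¹ :=
  ⟨fun h => by rw [← h, inv_inv'], fun h => by rw [h, inv_inv']⟩

theorem inv_one' : (1 : M)⁻¹ = 1 := by
  rw [← one_mul (1 : M)⁻¹, mul_inv]

theorem eq_inv_mul {x y z : M} : y = x⁻¹ * z ↔ x * y = z :=
  ⟨fun h => by rw [h, mul_inv_mul], fun h => by rw [← h, inv_mul_mul]⟩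

theorem eq_mul_inv {x y z : M} : y = z * x⁻¹ ↔ y * x = z :=
  ⟨fun h => by rw [h, mul_inv_cancel_mul], fun h => by rw [← h, mul_mul_inv]⟩

theorem mul_inv_rev' (x y : M) : (x * y)⁻¹ = y⁻¹ * x⁻¹ := by
  rw [eq_inv_mul]
  symm
  rw [← inv_mul_mul x (y * (x * y)⁻¹)]
  have h1 : y * (x * y)⁻¹ = x⁻¹ := by
    symm
    rw [eq_mul_inv, inv_mul_mul]
  rw [h1, mul_inv, mul_one]

theorem lsol_eq (a b : M) : lsol a b = a⁻¹ * b := by rw [eq_inv_mul, mul_lsol]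

theorem rsol_eq (a b : M) : rsol a b = b * a⁻¹ := by rw [eq_mul_inv, rsol_mul]

theorem isSubloopSet_of_inv {A : Set M} (h1 : (1 : M) ∈ A) (hm : ∀ x ∈ A, ∀ y ∈ A, x * y ∈ A)
    (hi : ∀ x ∈ A, x⁻¹ ∈ A) : IsSubloopSet A :=
  ⟨h1, hm, fun x hx y hy => by rw [lsol_eq]; exact hm _ (hi x hx) _ hy,
    fun x hx y hy => by rw [rsol_eq]; exact hm _ hy _ (hi x hx)⟩

theorem IsSubloopSet.inv_mem {A : Set M} (h : IsSubloopSet A) {x : M} (hx : x ∈ A) : x⁻¹ ∈ A :=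
  h.2.2.1 x hx 1 h.1

variable (M) in
/-- Inversion as a permutation. -/
noncomputable def invPerm : Equiv.Perm M := ⟨Inv.inv, Inv.inv, inv_inv', inv_inv'⟩

/-- Left multiplication as a permutation. -/
noncomputable def leftPerm (a : M) : Equiv.Perm M :=
  ⟨fun x => a * x, fun x => a⁻¹ * x, inv_mul_mul a, mul_inv_mul a⟩

/-- Right multiplication as a permutation. -/
noncomputable def rightPerm (a : M) : Equiv.Perm M :=
  ⟨fun x => x * a, fun x => x * a⁻¹, fun x => mul_mul_inv x a, fun x => mul_inv_cancel_mul x a⟩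

/-- The relation stating that the product of three elements is trivial. -/
def Tri (x y z : M) : Prop := x * y = z⁻¹

theorem tri_iff {x y z : M} : Tri x y z ↔ y * z = x⁻¹ := by
  rw [Tri, ← eq_inv_mul, ← eq_mul_inv]

theorem tri_rotate {x y z : M} : Tri x y z ↔ Tri y z x := tri_iff

theorem tri_inv {x y z : M} : Tri x⁻¹ z⁻¹ y⁻¹ ↔ Tri x y z := by
  rw [tri_iff, ← mul_inv_rev', inv_eq_iff, inv_inv', ← tri_iff]

variable (M) in
/-- The autotopisms: triples of permutations preserving `Tri`. -/
noncomputable def Auto : Subgroup (Equiv.Perm M × Equiv.Perm M × Equiv.Perm M) where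
  carrier := {g | ∀ x y z, Tri (g.1 x) (g.2.1 y) (g.2.2 z) ↔ Tri x y z}
  one_mem' _ _ _ := Iff.rfl
  mul_mem' hg hh x y z := (hg _ _ _).trans (hh x y z)
  inv_mem' {g} hg x y z := by
    have := hg (g.1⁻¹ x) (g.2.1⁻¹ y) (g.2.2⁻¹ z)
    simp only [Equiv.Perm.inv_def, Equiv.apply_symm_apply] at this
    exact this.symm

/-- Conjugation by inversion. -/
noncomputable def conjInv : Equiv.Perm M →* Equiv.Perm M := (MulAut.conj (invPerm M)).toMonoidHom

theorem conjInv_apply (g : Equiv.Perm M) (x : M) : conjInv g x = (g x⁻¹)⁻¹ := rfl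

@[simp] theorem conjInv_conjInv (g : Equiv.Perm M) : conjInv (conjInv g) = g := by
  ext x
  simp [conjInv_apply, inv_inv']

variable (M) in
/-- The involution of the autotopism group fixing the first place. -/
noncomputable def autoS : Auto M →* Auto M where
  toFun g := ⟨(conjInv g.1.1, conjInv g.1.2.2, conjInv g.1.2.1), fun x y z => by
    simp only [conjInv_apply]
    rw [tri_inv, g.2, tri_inv]⟩
  map_one' := by simp only [OneMemClass.coe_one, Prod.fst_one, Prod.snd_one, map_one]; rfl
  map_mul' g h := by
    simp only [Subgroup.coe_mul, Prod.fst_mul, Prod.snd_mul, map_mul]; rfl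

variable (M) in
/-- The involution of the autotopism group fixing the second place. -/
noncomputable def autoT : Auto M →* Auto M where
  toFun g := ⟨(conjInv g.1.2.2, conjInv g.1.2.1, conjInv g.1.1), fun x y z => by
    simp only [conjInv_apply]
    rw [← tri_rotate, tri_inv, g.2, tri_inv, tri_rotate]⟩
  map_one' := by simp only [OneMemClass.coe_one, Prod.fst_one, Prod.snd_one, map_one]; rfl
  map_mul' g h := by
    simp only [Subgroup.coe_mul, Prod.fst_mul, Prod.snd_mul, map_mul]; rfl

theorem coe_autoS (g : Auto M) :
    (autoS M g : Equiv.Perm M × Equiv.Perm M × Equiv.Perm M) =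
      (conjInv g.1.1, conjInv g.1.2.2, conjInv g.1.2.1) := rfl

theorem coe_autoT (g : Auto M) :
    (autoT M g : Equiv.Perm M × Equiv.Perm M × Equiv.Perm M) =
      (conjInv g.1.2.2, conjInv g.1.2.1, conjInv g.1.1) := rfl

theorem inv_mul_autoS (g : Auto M) {a : M} (ha : g.1.1 a = 1) :
    ((g⁻¹ * autoS M g : Auto M) : Equiv.Perm M × Equiv.Perm M × Equiv.Perm M) =
      (rightPerm a * leftPerm a, (leftPerm a)⁻¹, (rightPerm a)⁻¹) := by
  obtain ⟨⟨g0, g1, g2⟩, hg⟩ := g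
  replace ha : g0 a = 1 := ha
  replace hg : ∀ x y z, Tri (g0 x) (g1 y) (g2 z) ↔ Tri x y z := hg
  have h1 : ∀ y, g2 (a * y)⁻¹ = (g1 y)⁻¹ := fun y => by
    have := (hg a y (a * y)⁻¹).2 (by rw [Tri, inv_inv'])
    rwa [Tri, ha, one_mul, eq_comm, inv_eq_iff] at this
  refine Prod.ext ?_ (Prod.ext ?_ ?_)
  · ext x
    change g0⁻¹ (g0 x⁻¹)⁻¹ = (a * x) * a
    rw [Equiv.Perm.inv_eq_iff_eq]
    have e1 := (hg x⁻¹ x 1).2 (by rw [Tri, inv_mul, inv_one'])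
    rw [tri_iff] at e1
    have e2 := (hg ((a * x) * a) a⁻¹ (a * x)⁻¹).2 (by rw [Tri, mul_mul_inv, inv_inv'])
    have e3 := h1 a⁻¹
    rw [mul_inv, inv_one', eq_comm, inv_eq_iff] at e3
    rw [tri_iff, h1, e3, ← mul_inv_rev', e1, eq_comm, inv_eq_iff, inv_inv'] at e2
    exact e2.symm
  · ext x
    change g1⁻¹ (g2 x⁻¹)⁻¹ = a⁻¹ * x
    rw [Equiv.Perm.inv_eq_iff_eq, inv_eq_iff, ← h1, mul_inv_mul]
  · ext x
    change g2⁻¹ (g1 x⁻¹)⁻¹ = x * a⁻¹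
    rw [Equiv.Perm.inv_eq_iff_eq, ← h1, mul_inv_rev', inv_inv']

variable (M) in
/-- The triality structure on the autotopism group of a Moufang loop. -/
noncomputable def triality : Triality (Auto M) where
  s := autoS M
  t := autoT M
  ss g := Subtype.ext (by simp [coe_autoS])
  tt g := Subtype.ext (by simp [coe_autoT])
  tst g := Subtype.ext (by simp [coe_autoS, coe_autoT])
  tri g := by
    have h := inv_mul_autoS g (a := g.1.1⁻¹ 1) (by simp)
    generalize g.1.1⁻¹ 1 = a at h
    generalize g⁻¹ * autoS M g = u at h
    have e : rightPerm a * leftPerm a * (leftPerm a)⁻¹ * (rightPerm a)⁻¹ = 1 := by group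
    refine Subtype.ext ?_
    simp only [Subgroup.coe_mul, coe_autoS, coe_autoT, h, conjInv_conjInv, Prod.mk_mul_mk]
    refine Prod.ext e (Prod.ext ?_ ?_) <;> simp only [Subgroup.coe_one, Prod.snd_one, Prod.fst_one]
      <;> group

theorem coe_m (g : Auto M) {a : M} (ha : g.1.1 a = 1) :
    ((triality M).m g : Equiv.Perm M × Equiv.Perm M × Equiv.Perm M) =
      (rightPerm a * leftPerm a, (leftPerm a)⁻¹, (rightPerm a)⁻¹) := inv_mul_autoS g ha

/-- The autotopisms attached to an element of a Moufang loop. -/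
theorem mem_Auto (a : M) :
    (rightPerm a * leftPerm a, (leftPerm a)⁻¹, (rightPerm a)⁻¹) ∈ Auto M := by
  intro x y z
  change Tri ((a * x) * a) (a⁻¹ * y) (z * a⁻¹) ↔ Tri x y z
  have h := moufang a (a⁻¹ * y) (z * a⁻¹)
  rw [mul_inv_mul, mul_inv_cancel_mul] at h
  rw [tri_iff, tri_iff, h, mul_inv_rev', mul_inv_rev', eq_inv_mul, eq_mul_inv]

theorem mem_F_iff (g : Auto M) : g ∈ (triality M).F ↔ g.1.1 1 = 1 := by
  rw [Triality.mem_F, ← Triality.m_eq_one]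
  have h := coe_m g (a := g.1.1⁻¹ 1) (by simp)
  constructor
  · intro e
    rw [e] at h
    have h1 := congrArg (fun k => k.2.1 1) h
    change 1 = (g.1.1⁻¹ 1)⁻¹ * 1 at h1
    rw [mul_one, eq_comm, inv_eq_iff, inv_one', Equiv.Perm.inv_eq_iff_eq] at h1
    exact h1.symm
  · intro e
    have e1 : g.1.1⁻¹ 1 = 1 := by rw [Equiv.Perm.inv_eq_iff_eq, e]
    rw [e1] at h
    refine Subtype.ext (h.trans ?_)
    have hl : leftPerm (1 : M) = 1 := by ext x; exact one_mul x
    have hr : rightPerm (1 : M) = 1 := by ext x; exact mul_one x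
    rw [hl, hr, inv_one, _root_.mul_one]; rfl

end MoufangLoop

open scoped commutatorElement

namespace MoufangLoop

variable {M : Type u} [MoufangLoop M]

/-- The orbit of the identity element in the first place. -/
def orb (K : Subgroup (Auto M)) : Set M := {x | ∃ g ∈ K, g.1.1 1 = x}

theorem card_orb (K : Subgroup (Auto M)) : Nat.card (orb K) = (triality M).F.relIndex K := by
  let φ : K →* Equiv.Perm M :=
    (MonoidHom.fst (Equiv.Perm M) (Equiv.Perm M × Equiv.Perm M)).comp
      ((Auto M).subtype.comp K.subtype)
  let : MulAction K M := MulAction.compHom M φ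
  have h1 : MulAction.orbit K (1 : M) = orb K := by
    ext x
    constructor
    · rintro ⟨g, rfl⟩
      exact ⟨g, g.2, rfl⟩
    · rintro ⟨g, hg, rfl⟩
      exact ⟨⟨g, hg⟩, rfl⟩
  have h2 : MulAction.stabilizer K (1 : M) = (triality M).F.subgroupOf K := by
    ext g
    rw [Subgroup.mem_subgroupOf, mem_F_iff]
    rfl
  rw [← h1, Nat.card_coe_set_eq, ← MulAction.index_stabilizer, h2, Subgroup.relIndex]

theorem orb_top : orb (⊤ : Subgroup (Auto M)) = Set.univ := by
  refine Set.eq_univ_of_forall fun x => ?_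
  have h := mem_Auto x⁻¹
  refine ⟨(triality M).s ((triality M).t ⟨_, h⟩), trivial, ?_⟩
  change (conjInv (conjInv (rightPerm x⁻¹)⁻¹)) 1 = x
  rw [conjInv_conjInv]
  change 1 * x⁻¹⁻¹ = x
  rw [one_mul, inv_inv']

variable {K : Subgroup (Auto M)} (hK : (triality M).Inv K)

theorem exists_map_eq_one {a : M} (ha : a ∈ orb K) : ∃ g ∈ K, g.1.1 a = 1 := by
  obtain ⟨g, hg, rfl⟩ := ha
  refine ⟨g⁻¹, inv_mem hg, ?_⟩
  change g.1.1⁻¹ (g.1.1 1) = 1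
  rw [Equiv.Perm.inv_eq_iff_eq]

include hK

theorem mem_Auto_of_mem_orb {a : M} (ha : a ∈ orb K) :
    ⟨_, mem_Auto a⟩ ∈ K := by
  obtain ⟨g, hg, e⟩ := exists_map_eq_one ha
  have e' : ⟨_, mem_Auto a⟩ = (triality M).m g := Subtype.ext (coe_m g e).symm
  rw [e']
  exact hK.m_mem hg

theorem isSubloopSet_orb : IsSubloopSet (orb K) := by
  have h1 : (1 : M) ∈ orb K := ⟨1, one_mem _, rfl⟩
  have hd : ∀ b ∈ orb K, ∀ a ∈ orb K, b * a⁻¹ ∈ orb K := by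
    rintro _ ⟨g, hg, rfl⟩ a ha
    have := hK.1 _ (hK.2 _ (mem_Auto_of_mem_orb hK ha))
    refine ⟨_, mul_mem this hg, ?_⟩
    change (conjInv (conjInv (rightPerm a)⁻¹)) (g.1.1 1) = _
    rw [conjInv_conjInv]
    rfl
  have hi : ∀ a ∈ orb K, a⁻¹ ∈ orb K := fun a ha => one_mul a⁻¹ ▸ hd 1 h1 a ha
  exact isSubloopSet_of_inv h1 (fun x hx y hy => inv_inv' y ▸ hd x hx _ (hi y hy)) hi

omit hK in
theorem fst_mem_orb {g : Auto M} (hg : g ∈ K) {x : M} (hx : x ∈ orb K) : g.1.1 x ∈ orb K := by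
  obtain ⟨h, hh, rfl⟩ := hx
  exact ⟨g * h, mul_mem hg hh, rfl⟩

theorem snd_mem_orb {g : Auto M} (hg : g ∈ K) {x : M} (hx : x ∈ orb K) : g.1.2.1 x ∈ orb K := by
  have := fst_mem_orb (hK.2 _ (hK.1 _ hg)) hx
  change (conjInv (conjInv g.1.2.1)) x ∈ orb K at this
  rwa [conjInv_conjInv] at this

theorem thd_mem_orb {g : Auto M} (hg : g ∈ K) {x : M} (hx : x ∈ orb K) : g.1.2.2 x ∈ orb K := by
  have := fst_mem_orb (hK.1 _ (hK.2 _ hg)) hx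
  change (conjInv (conjInv g.1.2.2)) x ∈ orb K at this
  rwa [conjInv_conjInv] at this

variable {Q : Type*} [Group Q] {f : M → Q} (hf : ∀ x ∈ orb K, ∀ y ∈ orb K, f (x * y) = f x * f y)

/-- An autotopism inducing an autotopism of translation type on a group quotient. -/
structure Rel (K : Subgroup (Auto M)) (f : M → Q) (g : Auto M) (q : Q × Q × Q) : Prop where
  mem : g ∈ K
  fst : ∀ x ∈ orb K, f (g.1.1 x) = q.1 * f x * q.2.1⁻¹
  snd : ∀ x ∈ orb K, f (g.1.2.1 x) = q.2.1 * f x * q.2.2⁻¹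
  thd : ∀ x ∈ orb K, f (g.1.2.2 x) = q.2.2 * f x * q.1⁻¹

omit hK in
theorem Rel.one : Rel K f 1 (1 : Q × Q × Q) :=
  ⟨one_mem _, fun x _ => by simp, fun x _ => by simp, fun x _ => by simp⟩

theorem Rel.mul {g h : Auto M} {q q' : Q × Q × Q} (hg : Rel K f g q) (hh : Rel K f h q') :
    Rel K f (g * h) (q * q') := by
  refine ⟨mul_mem hg.mem hh.mem, fun x hx => ?_, fun x hx => ?_, fun x hx => ?_⟩
  · change f (g.1.1 (h.1.1 x)) = _
    rw [hg.fst _ (fst_mem_orb hh.mem hx), hh.fst _ hx]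
    simp [mul_assoc]
  · change f (g.1.2.1 (h.1.2.1 x)) = _
    rw [hg.snd _ (snd_mem_orb hK hh.mem hx), hh.snd _ hx]
    simp [mul_assoc]
  · change f (g.1.2.2 (h.1.2.2 x)) = _
    rw [hg.thd _ (thd_mem_orb hK hh.mem hx), hh.thd _ hx]
    simp [mul_assoc]

theorem Rel.inv {g : Auto M} {q : Q × Q × Q} (hg : Rel K f g q) : Rel K f g⁻¹ q⁻¹ := by
  refine ⟨inv_mem hg.mem, fun x hx => ?_, fun x hx => ?_, fun x hx => ?_⟩
  · have h := hg.fst _ (fst_mem_orb (inv_mem hg.mem) hx)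
    change f (g.1.1 (g.1.1⁻¹ x)) = q.1 * f (g.1.1⁻¹ x) * q.2.1⁻¹ at h
    change f (g.1.1⁻¹ x) = _
    rw [Equiv.Perm.inv_def, Equiv.apply_symm_apply] at h
    rw [h, Equiv.Perm.inv_def]
    simp [mul_assoc]
  · have h := hg.snd _ (snd_mem_orb hK (inv_mem hg.mem) hx)
    change f (g.1.2.1 (g.1.2.1⁻¹ x)) = q.2.1 * f (g.1.2.1⁻¹ x) * q.2.2⁻¹ at h
    change f (g.1.2.1⁻¹ x) = _
    rw [Equiv.Perm.inv_def, Equiv.apply_symm_apply] at h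
    rw [h, Equiv.Perm.inv_def]
    simp [mul_assoc]
  · have h := hg.thd _ (thd_mem_orb hK (inv_mem hg.mem) hx)
    change f (g.1.2.2 (g.1.2.2⁻¹ x)) = q.2.2 * f (g.1.2.2⁻¹ x) * q.1⁻¹ at h
    change f (g.1.2.2⁻¹ x) = _
    rw [Equiv.Perm.inv_def, Equiv.apply_symm_apply] at h
    rw [h, Equiv.Perm.inv_def]
    simp [mul_assoc]

/-- The autotopisms inducing an element of `S` on the quotient. -/
def relSubgroup (f : M → Q) (S : Subgroup (Q × Q × Q)) : Subgroup (Auto M) where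
  carrier := {g | ∃ q ∈ S, Rel K f g q}
  one_mem' := ⟨1, one_mem _, Rel.one⟩
  mul_mem' := fun ⟨q, hq, hg⟩ ⟨q', hq', hg'⟩ => ⟨q * q', mul_mem hq hq', hg.mul hK hg'⟩
  inv_mem' := fun ⟨q, hq, hg⟩ => ⟨q⁻¹, inv_mem hq, hg.inv hK⟩

theorem commutator_relSubgroup_le {S S' S'' : Subgroup (Q × Q × Q)} (h : ⁅S, S'⁆ ≤ S'') :
    ⁅relSubgroup hK f S, relSubgroup hK f S'⁆ ≤ relSubgroup hK f S'' := by
  rw [Subgroup.commutator_le]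
  rintro g ⟨q, hq, hg⟩ g' ⟨q', hq', hg'⟩
  exact ⟨⁅q, q'⁆, h (Subgroup.commutator_mem_commutator hq hq'),
    ((hg.mul hK hg').mul hK (hg.inv hK)).mul hK (hg'.inv hK)⟩

include hf

theorem map_one_of_mul : f 1 = 1 := by
  have h1 := (isSubloopSet_orb hK).1
  have := hf 1 h1 1 h1
  rw [one_mul] at this
  exact left_eq_mul.1 this

theorem map_inv_of_mul {x : M} (hx : x ∈ orb K) : f x⁻¹ = (f x)⁻¹ := by
  rw [eq_inv_iff_mul_eq_one, ← hf _ ((isSubloopSet_orb hK).inv_mem hx) _ hx, inv_mul,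
    map_one_of_mul hK hf]

theorem map_conjInv {g : Equiv.Perm M} (hg : ∀ x ∈ orb K, g x ∈ orb K) {a b : Q}
    (h : ∀ x ∈ orb K, f (g x) = a * f x * b⁻¹) : ∀ x ∈ orb K, f (conjInv g x) = b * f x * a⁻¹ := by
  intro x hx
  have hx' := (isSubloopSet_orb hK).inv_mem hx
  rw [conjInv_apply, map_inv_of_mul hK hf (hg _ hx'), h _ hx', map_inv_of_mul hK hf hx]
  group

theorem Rel.map_s {g : Auto M} {q : Q × Q × Q} (hg : Rel K f g q) :
    Rel K f ((triality M).s g) (q.2.1, q.1, q.2.2) where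
  mem := hK.1 _ hg.mem
  fst := map_conjInv hK hf (fun _ => fst_mem_orb hg.mem) hg.fst
  snd := map_conjInv hK hf (fun _ => thd_mem_orb hK hg.mem) hg.thd
  thd := map_conjInv hK hf (fun _ => snd_mem_orb hK hg.mem) hg.snd

theorem Rel.map_t {g : Auto M} {q : Q × Q × Q} (hg : Rel K f g q) :
    Rel K f ((triality M).t g) (q.1, q.2.2, q.2.1) where
  mem := hK.2 _ hg.mem
  fst := map_conjInv hK hf (fun _ => thd_mem_orb hK hg.mem) hg.thd
  snd := map_conjInv hK hf (fun _ => snd_mem_orb hK hg.mem) hg.snd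
  thd := map_conjInv hK hf (fun _ => fst_mem_orb hg.mem) hg.fst

theorem rel_m {g : Auto M} (hg : g ∈ K) {a : M} (ha : g.1.1 a = 1) (haK : a ∈ orb K) :
    Rel K f ((triality M).m g) (f a, (f a)⁻¹, 1) := by
  have hA := isSubloopSet_orb hK
  have hi := hA.inv_mem haK
  refine ⟨hK.m_mem hg, fun x hx => ?_, fun x hx => ?_, fun x hx => ?_⟩ <;> rw [coe_m g ha]
  · change f ((a * x) * a) = _
    rw [hf _ (hA.2.1 _ haK _ hx) _ haK, hf _ haK _ hx, inv_inv]
  · change f (a⁻¹ * x) = _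
    rw [hf _ hi _ hx, map_inv_of_mul hK hf haK]
    simp
  · change f (x * a⁻¹) = _
    rw [hf _ hx _ hi, map_inv_of_mul hK hf haK]
    simp

theorem tripleComm_le : (triality M).tripleComm K ≤ relSubgroup hK f ⊥ := by
  have h1 : (triality M).G1 K ≤
      relSubgroup hK f ((⊤ : Subgroup Q).prod ((⊤ : Subgroup Q).prod ⊥)) := by
    rw [Triality.G1, Subgroup.closure_le]
    rintro _ ⟨g, hg, rfl⟩
    have ha : g.1.1⁻¹ 1 ∈ orb K := ⟨g⁻¹, inv_mem hg, rfl⟩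
    exact ⟨_, by simp [Subgroup.mem_prod], rel_m hK hf hg (a := g.1.1⁻¹ 1) (by simp) ha⟩
  have h2 : ((triality M).G1 K).map (triality M).t ≤
      relSubgroup hK f ((⊤ : Subgroup Q).prod ((⊥ : Subgroup Q).prod ⊤)) := by
    rintro _ ⟨g, hg, rfl⟩
    obtain ⟨q, hq, hr⟩ := h1 hg
    exact ⟨_, by simpa [Subgroup.mem_prod] using hq, hr.map_t hK hf⟩
  have h3 : (((triality M).G1 K).map (triality M).t).map (triality M).s ≤
      relSubgroup hK f ((⊥ : Subgroup Q).prod ((⊤ : Subgroup Q).prod ⊤)) := by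
    rintro _ ⟨g, hg, rfl⟩
    obtain ⟨q, hq, hr⟩ := h2 hg
    exact ⟨_, by simpa [Subgroup.mem_prod] using hq, hr.map_s hK hf⟩
  have h4 := (Subgroup.commutator_mono h1 h2).trans (commutator_relSubgroup_le hK
    (S'' := (⊤ : Subgroup Q).prod ((⊥ : Subgroup Q).prod ⊥)) (by
      rw [Subgroup.commutator_le]
      rintro ⟨a, b, c⟩ hq ⟨a', b', c'⟩ hq'
      simp only [Subgroup.mem_prod, Subgroup.mem_top, Subgroup.mem_bot, true_and, and_true]
        at hq hq' ⊢
      subst hq hq'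
      simp [commutatorElement_def]))
  refine (Subgroup.commutator_mono h4 h3).trans (commutator_relSubgroup_le hK ?_)
  rw [Subgroup.commutator_le]
  rintro ⟨a, b, c⟩ hq ⟨a', b', c'⟩ hq'
  simp only [Subgroup.mem_prod, Subgroup.mem_top, Subgroup.mem_bot, true_and, and_true] at hq hq' ⊢
  obtain ⟨rfl, rfl⟩ := hq
  subst hq'
  simp [commutatorElement_def]

omit hK hf

/-- The autotopism group of a Moufang loop all of whose nontrivial subloops have a nontrivial
homomorphism to a group. -/
theorem triality_GT (h : ∀ A : Set M, IsSubloopSet A → A ≠ {1} → ∃ (Q : Type u) (_ : Group Q)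
    (f : M → Q), (∀ x ∈ A, ∀ y ∈ A, f (x * y) = f x * f y) ∧ ∃ a ∈ A, f a ≠ 1) :
    (triality M).GT := by
  rintro K hK ⟨g, hg, hne⟩
  have hA : orb K ≠ {1} := by
    intro e
    refine hne ((mem_F_iff g).2 ?_)
    have : g.1.1 1 ∈ orb K := ⟨g, hg, rfl⟩
    rwa [e] at this
  obtain ⟨Q, _, f, hf, a, ha, hfa⟩ := h (orb K) (isSubloopSet_orb hK) hA
  refine ⟨relSubgroup hK f ⊥, ?_, ⟨?_, ?_⟩, tripleComm_le hK hf, ?_⟩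
  · rintro _ ⟨q, -, hr⟩
    exact hr.mem
  · rintro g ⟨q, hq, hr⟩
    rw [Subgroup.mem_bot] at hq
    subst hq
    exact ⟨_, one_mem _, hr.map_s hK hf⟩
  · rintro g ⟨q, hq, hr⟩
    rw [Subgroup.mem_bot] at hq
    subst hq
    exact ⟨_, one_mem _, hr.map_t hK hf⟩
  · obtain ⟨g, hg, e⟩ := exists_map_eq_one ha
    refine ⟨g, hg, ?_⟩
    rintro ⟨q, hq, hr⟩
    rw [Subgroup.mem_bot] at hq
    subst hq
    have h1 := (isSubloopSet_orb hK).1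
    have e1 := hr.thd a ha
    rw [coe_m g e] at e1
    change f (a * a⁻¹) = _ at e1
    rw [mul_inv, map_one_of_mul hK hf] at e1
    simp at e1
    exact hfa e1.symm

end MoufangLoop

namespace MoufangLoop

variable {M : Type u} [MoufangLoop M] {A B D : Set M}

theorem singleton_mul_inv_mul (x : M) (C : Set M) : ({x} : Set M) * (({x⁻¹} : Set M) * C) = C := by
  simp [Set.singleton_mul, Set.image_image, mul_inv_mul]

theorem singleton_inv_mul_mul (x : M) (C : Set M) : ({x⁻¹} : Set M) * (({x} : Set M) * C) = C := by
  simp [Set.singleton_mul, Set.image_image, inv_mul_mul]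

theorem IsNormalIn.mul_coset (hA : IsSubloopSet A) (hN : IsNormalIn B A) {x y : M} (hx : x ∈ A)
    (hy : y ∈ A) : ({x} : Set M) * (({y} : Set M) * B) = ({x * y} : Set M) * B := by
  rw [← hN.2.1 y hy, ← hN.2.2.2 x hx y hy, ← hN.2.1 x hx, ← hN.2.2.1 x hx y hy,
    hN.2.1 _ (hA.2.1 x hx y hy)]

theorem IsSubloopSet.singleton_mul (hB : IsSubloopSet B) {b : M} (hb : b ∈ B) :
    ({b} : Set M) * B = B := by
  rw [Set.singleton_mul]
  ext x
  constructor
  · rintro ⟨y, hy, rfl⟩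
    exact hB.2.1 b hb y hy
  · exact fun hx => ⟨b⁻¹ * x, hB.2.1 _ (hB.inv_mem hb) _ hx, mul_inv_mul b x⟩

theorem IsNormalIn.coset_eq (hA : IsSubloopSet A) (hB : IsSubloopSet B) (hN : IsNormalIn B A)
    {x y : M} (hy : y ∈ A) (h : x ∈ ({y} : Set M) * B) : ({x} : Set M) * B = ({y} : Set M) * B := by
  obtain ⟨_, rfl, b, hb, rfl⟩ := h
  dsimp only
  rw [← hN.mul_coset hA hy (hN.1 hb), hB.singleton_mul hb]

/-- The cosets of `B` in `A`. -/
abbrev Cosets (A B : Set M) : Type u := {C : Set M // ∃ y ∈ A, C = ({y} : Set M) * B}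

/-- Left multiplication as a permutation of the cosets. -/
noncomputable def cosetPerm (hA : IsSubloopSet A) (hN : IsNormalIn B A) {x : M} (hx : x ∈ A) :
    Equiv.Perm (Cosets A B) where
  toFun C := ⟨({x} : Set M) * C.1, by
    obtain ⟨C, y, hy, rfl⟩ := C
    exact ⟨x * y, hA.2.1 x hx y hy, hN.mul_coset hA hx hy⟩⟩
  invFun C := ⟨({x⁻¹} : Set M) * C.1, by
    obtain ⟨C, y, hy, rfl⟩ := C
    have hx' := hA.inv_mem hx
    exact ⟨x⁻¹ * y, hA.2.1 _ hx' y hy, hN.mul_coset hA hx' hy⟩⟩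
  left_inv C := Subtype.ext (singleton_inv_mul_mul x C.1)
  right_inv C := Subtype.ext (singleton_mul_inv_mul x C.1)

/-- An associative factor is realized by a homomorphism to a group. -/
theorem exists_hom_of_factorAssociative [Finite M] (hA : IsSubloopSet A) (hB : IsSubloopSet B)
    (hN : IsNormalIn B A) (hF : FactorAssociative A B) :
    ∃ (Q : Type u) (_ : Group Q) (_ : Finite Q) (f : M → Q),
      (∀ x ∈ A, ∀ y ∈ A, f (x * y) = f x * f y) ∧ ∀ x ∈ A, f x = 1 ↔ x ∈ B := by
  classical
  let f : M → Equiv.Perm (Cosets A B) := fun x => if hx : x ∈ A then cosetPerm hA hN hx else 1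
  have hf : ∀ x ∈ A, ∀ C, (f x C).1 = ({x} : Set M) * C.1 := fun x hx C => by
    simp only [f, dif_pos hx]
    rfl
  refine ⟨_, inferInstance, inferInstance, f, fun x hx y hy => ?_,
    fun x hx => ⟨fun h => ?_, fun h => ?_⟩⟩
  · refine Equiv.ext fun C => Subtype.ext ?_
    obtain ⟨z, hz, e⟩ := C.2
    have hxy := hA.2.1 x hx y hy
    have hyz := hA.2.1 y hy z hz
    change _ = (f x (f y C)).1
    rw [hf _ hxy, hf _ hx, hf _ hy, e, hN.mul_coset hA hxy hz, hN.mul_coset hA hy hz,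
      hN.mul_coset hA hx hyz]
    exact hN.coset_eq hA hB (hA.2.1 x hx _ hyz) (hF x hx y hy z hz)
  · have h1 := hf x hx ⟨({1} : Set M) * B, 1, hA.1, rfl⟩
    rw [h] at h1
    change ({1} : Set M) * B = ({x} : Set M) * (({1} : Set M) * B) at h1
    rw [hB.singleton_mul hB.1] at h1
    rw [h1]
    exact ⟨x, rfl, 1, hB.1, mul_one x⟩
  · refine Equiv.ext fun C => Subtype.ext ?_
    obtain ⟨z, hz, e⟩ := C.2
    change _ = C.1
    rw [hf x hx, e, hN.mul_coset hA hx hz]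
    refine hN.coset_eq hA hB hz ?_
    rw [← hN.2.1 z hz]
    exact ⟨x, h, z, rfl, rfl⟩

section Lagrange

variable {Q : Type*} [Group Q] {f : M → Q} (hf : ∀ x ∈ A, ∀ y ∈ A, f (x * y) = f x * f y)
include hf

/-- The image of a subloop under a homomorphism to a group. -/
def imageSubgroup (hD : IsSubloopSet D) (hDA : D ⊆ A) : Subgroup Q where
  carrier := f '' D
  one_mem' := by
    refine ⟨1, hD.1, ?_⟩
    have := hf 1 (hDA hD.1) 1 (hDA hD.1)
    rw [one_mul] at this
    exact left_eq_mul.1 this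
  mul_mem' := by
    rintro _ _ ⟨x, hx, rfl⟩ ⟨y, hy, rfl⟩
    exact ⟨x * y, hD.2.1 x hx y hy, hf x (hDA hx) y (hDA hy)⟩
  inv_mem' := by
    rintro _ ⟨x, hx, rfl⟩
    have hx' := hD.inv_mem hx
    have h1 := hf 1 (hDA hD.1) 1 (hDA hD.1)
    rw [one_mul, left_eq_mul] at h1
    refine ⟨x⁻¹, hx', ?_⟩
    rw [eq_inv_iff_mul_eq_one, ← hf _ (hDA hx') _ (hDA hx), inv_mul, h1]

theorem card_eq_mul_card_inter (hB : ∀ x ∈ A, f x = 1 ↔ x ∈ B) (hD : IsSubloopSet D)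
    (hDA : D ⊆ A) : Nat.card D = Nat.card (imageSubgroup hf hD hDA) * Nat.card (D ∩ B : Set M) := by
  have hσ : ∀ q : imageSubgroup hf hD hDA, ∃ x ∈ D, f x = q := fun q => q.2
  choose σ hσD hσf using hσ
  rw [← Nat.card_prod]
  symm
  let e : imageSubgroup hf hD hDA × (D ∩ B : Set M) → D :=
    fun u => ⟨σ u.1 * u.2.1, hD.2.1 _ (hσD _) _ u.2.2.1⟩
  refine Nat.card_congr (Equiv.ofBijective e ⟨?_, ?_⟩)
  · rintro ⟨q, b, hb⟩ ⟨q', b', hb'⟩ h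
    have h1 : σ q * b = σ q' * b' := congrArg Subtype.val h
    have h2 := congrArg f h1
    rw [hf _ (hDA (hσD q)) _ (hDA hb.1), hf _ (hDA (hσD q')) _ (hDA hb'.1),
      (hB b (hDA hb.1)).2 hb.2, (hB b' (hDA hb'.1)).2 hb'.2, _root_.mul_one, _root_.mul_one, hσf,
      hσf] at h2
    have h3 : q = q' := Subtype.ext h2
    subst h3
    have h4 := mul_left_cancel' h1
    subst h4
    rfl
  · rintro ⟨d, hd⟩
    let q : imageSubgroup hf hD hDA := ⟨f d, d, hd, rfl⟩
    have hb : (σ q)⁻¹ * d ∈ D := hD.2.1 _ (hD.inv_mem (hσD q)) _ hd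
    have hb' : f ((σ q)⁻¹ * d) = 1 := by
      have h1 := hf _ (hDA (hσD q)) _ (hDA hb)
      rw [mul_inv_mul, hσf] at h1
      exact left_eq_mul.1 h1
    exact ⟨⟨q, ⟨_, hb, (hB _ (hDA hb)).1 hb'⟩⟩, Subtype.ext (mul_inv_mul _ _)⟩

end Lagrange

theorem IsSubloopSet.inter (hA : IsSubloopSet A) (hB : IsSubloopSet B) : IsSubloopSet (A ∩ B) :=
  isSubloopSet_of_inv ⟨hA.1, hB.1⟩
    (fun x hx y hy => ⟨hA.2.1 x hx.1 y hy.1, hB.2.1 x hx.2 y hy.2⟩)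
    fun _ hx => ⟨hA.inv_mem hx.1, hB.inv_mem hx.2⟩

theorem isSubloopSet_singleton_one : IsSubloopSet ({1} : Set M) :=
  isSubloopSet_of_inv rfl (by rintro _ rfl _ rfl; exact one_mul 1) (by rintro _ rfl; exact inv_one')

theorem isNormalIn_singleton_one (hA : IsSubloopSet A) : IsNormalIn ({1} : Set M) A := by
  refine ⟨by rintro _ rfl; exact hA.1, ?_, ?_, ?_⟩ <;> intros <;>
    simp only [Set.singleton_mul_singleton, one_mul, mul_one]

theorem exists_compSeriesOn [Finite M] (A : Set M) (hA : IsSubloopSet A) :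
    Nonempty (CompSeriesOn M A) := by
  induction hn : A.ncard using Nat.strong_induction_on generalizing A with | _ n IH
  subst hn
  by_cases h1 : A = {1}
  · exact ⟨⟨0, fun _ => A, fun _ => hA, rfl, h1, fun i => i.elim0, fun i => i.elim0,
      fun i => i.elim0⟩⟩
  · obtain ⟨B, hB⟩ := (Set.toFinite
      {D : Set M | IsSubloopSet D ∧ IsNormalIn D A ∧ D ≠ A}).exists_maximal
      ⟨{1}, isSubloopSet_singleton_one, isNormalIn_singleton_one hA, Ne.symm h1⟩
    obtain ⟨⟨hBs, hBn, hBA⟩, hmax⟩ := hB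
    obtain ⟨s⟩ := IH _ (Set.ncard_lt_ncard (lt_of_le_of_ne hBn.1 hBA)) B hBs rfl
    refine ⟨⟨s.n + 1, Fin.cons A s.c, ?_, rfl, ?_, ?_, ?_, ?_⟩⟩
    · exact Fin.cases hA s.subloop
    · exact s.last
    · refine Fin.cases ?_ fun i => ?_
      · change IsNormalIn (s.c 0) A
        rwa [s.first]
      · exact s.normal i
    · refine Fin.cases ?_ fun i => ?_
      · change s.c 0 ≠ A
        rwa [s.first]
      · exact s.proper i
    · refine Fin.cases ?_ fun i => ?_
      · change ∀ D : Set M, IsSubloopSet D → IsNormalIn D A → s.c 0 ⊆ D → D = s.c 0 ∨ D = A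
        rw [s.first]
        intro D hD hDn hBD
        by_cases h : D = A
        · exact .inr h
        · exact .inl (le_antisymm (hmax ⟨hD, hDn, h⟩ hBD) hBD)
      · exact s.maximal i

theorem isSubloopSet_univ : IsSubloopSet (Set.univ : Set M) :=
  ⟨trivial, fun _ _ _ _ => trivial, fun _ _ _ _ => trivial, fun _ _ _ _ => trivial⟩

section Series

variable [Finite M] (s : CompSeries M)
  (hs : ∀ i : Fin s.n, FactorAssociative (s.c i.castSucc) (s.c i.succ))
include hs

theorem exists_hom_ne_one (hA : IsSubloopSet A) (h1 : A ≠ {1}) :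
    ∃ (Q : Type u) (_ : Group Q) (f : M → Q),
      (∀ x ∈ A, ∀ y ∈ A, f (x * y) = f x * f y) ∧ ∃ a ∈ A, f a ≠ 1 := by
  have key : ∀ i, A ⊆ s.c i → ∃ (Q : Type u) (_ : Group Q) (f : M → Q),
      (∀ x ∈ A, ∀ y ∈ A, f (x * y) = f x * f y) ∧ ∃ a ∈ A, f a ≠ 1 := by
    refine Fin.reverseInduction (fun h => ?_) fun i ih h => ?_
    · rw [s.last] at h
      exact absurd (h.antisymm (Set.singleton_subset_iff.2 hA.1)) h1
    · by_cases h' : A ⊆ s.c i.succ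
      · exact ih h'
      · obtain ⟨a, ha, ha'⟩ := Set.not_subset.1 h'
        obtain ⟨Q, hQ, -, f, hf, hf1⟩ := exists_hom_of_factorAssociative (s.subloop i.castSucc)
          (s.subloop i.succ) (s.normal i) (hs i)
        exact ⟨Q, hQ, f, fun x hx y hy => hf x (h hx) y (h hy), a, ha,
          fun e => ha' ((hf1 a (h ha)).1 e)⟩
  exact key 0 (by rw [s.first]; exact Set.subset_univ A)

/-- Lagrange's theorem for a loop whose composition factors are groups. -/
theorem card_dvd_of_isSubloopSet (hA : IsSubloopSet A) : Nat.card A ∣ Nat.card M := by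
  have key : ∀ i, Nat.card (A ∩ s.c i : Set M) ∣ Nat.card (s.c i) := by
    refine Fin.reverseInduction ?_ fun i ih => ?_
    · rw [s.last, Set.inter_eq_right.2 (Set.singleton_subset_iff.2 hA.1)]
    · have hc := s.subloop i.castSucc
      obtain ⟨Q, _, _, f, hf, hf1⟩ := exists_hom_of_factorAssociative hc
        (s.subloop i.succ) (s.normal i) (hs i)
      have hi := hA.inter hc
      rw [card_eq_mul_card_inter hf hf1 hc subset_rfl,
        card_eq_mul_card_inter hf hf1 hi Set.inter_subset_right, Set.inter_assoc,
        Set.inter_eq_right.2 (s.normal i).1]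
      refine mul_dvd_mul (Subgroup.card_dvd_of_le ?_) ih
      rintro _ ⟨x, hx, rfl⟩
      exact ⟨x, hx.2, rfl⟩
  have := key 0
  rwa [s.first, Set.inter_univ, Nat.card_univ] at this

end Series

end MoufangLoop

/-- If all composition factors of a finite Moufang loop `M` are associative (i.e. groups),
then `M` has a `p`-Sylow subloop for every prime `p`. -/
theorem sylow_subloop_of_group_type (M : Type) [MoufangLoop M] [Finite M]
    (hGT : ∀ (s : MoufangLoop.CompSeries M) (i : Fin s.n),
      MoufangLoop.FactorAssociative (s.c i.castSucc) (s.c i.succ))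
    (p : ℕ) (hp : p.Prime) :
    ∃ A : Set M, MoufangLoop.IsPSylowSubloop p A := by
  obtain ⟨s⟩ := MoufangLoop.exists_compSeriesOn (M := M) Set.univ MoufangLoop.isSubloopSet_univ
  have hs := hGT s
  have : Fact p.Prime := ⟨hp⟩
  obtain ⟨P, hP, hI, hk⟩ := Triality.GT.hasSylow (p := p) (MoufangLoop.triality M)
    (MoufangLoop.triality_GT fun A hA h1 => MoufangLoop.exists_hom_ne_one s hs hA h1)
  have hA := MoufangLoop.isSubloopSet_orb hI
  have h0 : Nat.card M ≠ 0 := by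
    have : Nonempty M := ⟨1⟩
    exact Nat.card_pos.ne'
  have hindex : (MoufangLoop.triality M).F.index = Nat.card M := by
    rw [← Subgroup.relIndex_top_right, ← MoufangLoop.card_orb, MoufangLoop.orb_top, Nat.card_univ]
  refine ⟨_, hA, ?_⟩
  obtain ⟨n, hn⟩ := IsPGroup.iff_card.1 hP
  have hd : Nat.card (MoufangLoop.orb P) ∣ p ^ n := by
    rw [MoufangLoop.card_orb, ← hn]
    exact Subgroup.relIndex_dvd_card _ _
  obtain ⟨m, -, hm⟩ := (Nat.dvd_prime_pow hp).1 hd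
  have hv := hk ((Nat.card M).factorization p) (hindex ▸ Nat.ordProj_dvd _ p)
  rw [← MoufangLoop.card_orb] at hv
  refine Nat.dvd_antisymm ?_ hv
  have hM := MoufangLoop.card_dvd_of_isSubloopSet s hs hA
  rw [hm] at hM ⊢
  exact pow_dvd_pow p ((hp.pow_dvd_iff_le_factorization h0).1 hM)
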